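/- Let M be a compact connected oriented n-manifold, n ≥ 2, and let ε > 0. Then there exists a relative integral cycle z ∈ Cₙ(M,∂M;ℤ) with associated pseudomanifold P such that: (1) [z] = d·[M,∂M]_ℤ in Hₙ(M,∂M;ℤ) for some integer d > 0 and ‖z‖_ℤ/d ≤ ‖M,∂M‖ + ε; (2) P is connected; (3) every n-simplex of P has at most n−1 boundary (n−1)-faces, and in particular ‖∂z‖_ℤ ≤ (n−1)·‖z‖_ℤ. -/

import Mathlib

open scoped BigOperators
set_option maxSynthPendingDepth 3
noncomputable section

/-! ## The standard topological simplex and singular chains -/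

/-- The standard topological `n`-simplex. -/
def TSimplex (n : ℕ) : Type :=
  {x : Fin (n + 1) → ℝ // (∀ i, 0 ≤ x i) ∧ ∑ i, x i = 1}

instance (n : ℕ) : TopologicalSpace (TSimplex n) := instTopologicalSpaceSubtype

/-- The affine inclusion of the `i`-th face of the standard `(n+1)`-simplex. -/
def faceMap {n : ℕ} (i : Fin (n + 2)) : C(TSimplex n, TSimplex (n + 1)) where
  toFun x := ⟨fun j => ∑ k ∈ Finset.univ.filter (fun k => i.succAbove k = j), x.1 k, by
    constructor
    · intro j
      exact Finset.sum_nonneg fun k _ => x.2.1 k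
    · rw [Finset.sum_fiberwise_of_maps_to (fun k _ => Finset.mem_univ (i.succAbove k)), x.2.2]⟩
  continuous_toFun := by
    apply Continuous.subtype_mk
    exact continuous_pi fun j => continuous_finset_sum _ fun k _ =>
      (continuous_apply k).comp continuous_subtype_val

/-- The `j`-th vertex of the standard simplex. -/
def vertexPt {m : ℕ} (j : Fin (m + 1)) : TSimplex m :=
  ⟨fun i => if i = j then 1 else 0, by
    constructor
    · intro i; dsimp only; split <;> norm_num
    · simp⟩

set_option linter.unnecessarySeqFocus false in
/-- The affine map of the standard `1`-simplex onto the edge of the standard `k`-simplex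
joining the vertices `a` and `b`. -/
def segMap {k : ℕ} (a b : Fin (k + 1)) : C(TSimplex 1, TSimplex k) where
  toFun x := ⟨fun j => (if j = a then x.1 0 else 0) + (if j = b then x.1 1 else 0), by
    constructor
    · intro j
      have h0 := x.2.1 0
      have h1 := x.2.1 1
      dsimp only
      split <;> split <;> simp_all <;> positivity
    · have := x.2.2
      rw [Finset.sum_add_distrib]
      simp [Finset.sum_ite_eq', ← this, Fin.sum_univ_two]⟩
  continuous_toFun := by
    apply Continuous.subtype_mk
    apply continuous_pi
    intro j
    apply Continuous.add
    · split
      · exact (continuous_apply (0 : Fin 2)).comp continuous_subtype_val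
      · exact continuous_const
    · split
      · exact (continuous_apply (1 : Fin 2)).comp continuous_subtype_val
      · exact continuous_const

/-- A singular `n`-simplex in `X`. -/
abbrev SingSimplex (n : ℕ) (X : Type) [TopologicalSpace X] : Type := C(TSimplex n, X)

/-- Singular `n`-chains in `X` with coefficients in `R`. -/
abbrev SChain (R : Type) [Zero R] (n : ℕ) (X : Type) [TopologicalSpace X] : Type :=
  SingSimplex n X →₀ R

/-- The singular boundary operator. -/
def sbdry (R : Type) [CommRing R] {n : ℕ} {X : Type} [TopologicalSpace X] :
    SChain R (n + 1) X →ₗ[R] SChain R n X :=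
  Finsupp.lsum R fun σ => LinearMap.toSpanSingleton R _
    (∑ i : Fin (n + 2), ((-1 : ℤ) ^ (i : ℕ)) • Finsupp.single (σ.comp (faceMap i)) (1 : R))

/-- The singular boundary operator, from degree `n` to degree `n - 1`. -/
def sbdryN (R : Type) [CommRing R] (n : ℕ) {X : Type} [TopologicalSpace X] :
    SChain R n X →ₗ[R] SChain R (n - 1) X :=
  match n with
  | 0 => 0
  | (_ + 1) => sbdry R

/-- The `j`-th face of a singular `n`-simplex. -/
def faceOf {X : Type} [TopologicalSpace X] :
    (n : ℕ) → Fin (n + 1) → SingSimplex n X → SingSimplex (n - 1) X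
  | 0, _, σ => σ
  | (_ + 1), k, σ => σ.comp (faceMap k)

/-- The edge of a singular `k`-simplex joining its `a`-th and `b`-th vertices. -/
def edgeOf {X : Type} [TopologicalSpace X] {k : ℕ} (a b : Fin (k + 1))
    (σ : SingSimplex k X) : SingSimplex 1 X :=
  σ.comp (segMap a b)

/-- The submodule of chains supported on a subspace `A`. -/
def suppOn (R : Type) [CommRing R] (n : ℕ) {X : Type} [TopologicalSpace X] (A : Set X) :
    Submodule R (SChain R n X) :=
  Finsupp.supported R R {σ : SingSimplex n X | Set.range ⇑σ ⊆ A}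

/-- `z` is a relative cycle of the pair `(X, A)`. -/
def IsRelCycle (R : Type) [CommRing R] (n : ℕ) {X : Type} [TopologicalSpace X] (A : Set X)
    (z : SChain R n X) : Prop :=
  sbdryN R n z ∈ suppOn R (n - 1) A

/-- Two chains are homologous relative to `A`. -/
def RelHomologous (R : Type) [CommRing R] (n : ℕ) {X : Type} [TopologicalSpace X] (A : Set X)
    (z z' : SChain R n X) : Prop :=
  ∃ w : SChain R (n + 1) X, z - z' - sbdry R w ∈ suppOn R n A

/-- The ℓ¹-norm of a relative chain: the sum of the norms of the coefficients of the
simplices not contained in `A`. -/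
def relNorm {R : Type} [NormedCommRing R] {n : ℕ} {X : Type} [TopologicalSpace X]
    (A : Set X) (z : SChain R n X) : ℝ :=
  letI : DecidablePred fun σ : SingSimplex n X => ¬ Set.range ⇑σ ⊆ A :=
    fun _ => Classical.dec _
  ∑ σ ∈ z.support.filter (fun σ : SingSimplex n X => ¬ Set.range ⇑σ ⊆ A), ‖z σ‖

/-- `c` is an integral fundamental cycle of the pair `(X, A)` in degree `n`: it is a relative
cycle whose class generates `H_n(X, A; ℤ)`.  For a compact connected oriented `n`-manifold
`X` with boundary `A`, this holds exactly for the representatives of `±[X, A]`. -/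
def IsFundCycle (n : ℕ) {X : Type} [TopologicalSpace X] (A : Set X) (c : SChain ℤ n X) : Prop :=
  IsRelCycle ℤ n A c ∧
    ∀ z : SChain ℤ n X, IsRelCycle ℤ n A z → ∃ k : ℤ, RelHomologous ℤ n A z (k • c)

/-- Change of coefficients `ℤ → ℝ` on chains. -/
def intToReal {n : ℕ} {X : Type} [TopologicalSpace X] (c : SChain ℤ n X) : SChain ℝ n X :=
  Finsupp.mapRange (fun k : ℤ => (k : ℝ)) (by norm_num) c

/-- Change of coefficients `ℤ → ℚ` on chains. -/
def intToRat {n : ℕ} {X : Type} [TopologicalSpace X] (c : SChain ℤ n X) : SChain ℚ n X :=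
  Finsupp.mapRange (fun k : ℤ => (k : ℚ)) (by norm_num) c

/-- Change of coefficients `ℚ → ℝ` on chains. -/
def ratToReal {n : ℕ} {X : Type} [TopologicalSpace X] (c : SChain ℚ n X) : SChain ℝ n X :=
  Finsupp.mapRange (fun k : ℚ => (k : ℝ)) (by norm_num) c

/-- The pair `(X, A)` is homologically orientable in degree `n`: the `n`-th relative
integral homology has a generator which is not trivial. -/
def HomOrientable (n : ℕ) (X : Type) [TopologicalSpace X] (A : Set X) : Prop :=
  ∃ c : SChain ℤ n X, IsFundCycle n A c ∧ ¬ RelHomologous ℤ n A c 0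

/-- The simplicial volume of a pair `(X, A)`, where `X` is a compact connected oriented
`n`-manifold with boundary `A`: the infimum of the ℓ¹-norms of the real relative cycles
representing (the real image of) an integral fundamental class. -/
def simVolOr (n : ℕ) (X : Type) [TopologicalSpace X] (A : Set X) : ℝ :=
  sInf {r : ℝ | ∃ z : SChain ℝ n X,
    (∃ c : SChain ℤ n X, IsFundCycle n A c ∧ RelHomologous ℝ n A z (intToReal c)) ∧
    r = relNorm A z}

/-- Rational version of `simVolOr`. -/
def simVolOrQ (n : ℕ) (X : Type) [TopologicalSpace X] (A : Set X) : ℝ :=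
  sInf {r : ℝ | ∃ z : SChain ℚ n X,
    (∃ c : SChain ℤ n X, IsFundCycle n A c ∧ RelHomologous ℚ n A z (intToRat c)) ∧
    r = relNorm A z}

/-- `p` is a two-sheeted covering map. -/
def IsDoubleCover {Y X : Type} [TopologicalSpace Y] [TopologicalSpace X] (p : Y → X) : Prop :=
  IsCoveringMap p ∧ ∀ x : X, Nat.card (p ⁻¹' {x}) = 2

/-- Simplicial volume of a connected pair: the norm of the fundamental class if the pair is
(homologically) orientable, and one half of the simplicial volume of the orientable double
cover otherwise. -/
def simVolConn (n : ℕ) (X : Type) [TopologicalSpace X] (A : Set X) : ℝ :=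
  letI := Classical.propDecidable (HomOrientable n X A)
  if HomOrientable n X A then simVolOr n X A
  else (1 / 2) * sInf {r : ℝ | ∃ (Y : TopCat.{0}) (p : ↥Y → X), IsDoubleCover p ∧
    HomOrientable n ↥Y (p ⁻¹' A) ∧ r = simVolOr n ↥Y (p ⁻¹' A)}

/-- The simplicial volume `‖X, A‖` of a compact manifold `X` with boundary `A`:
the sum over the connected components. -/
def SimVol (n : ℕ) (X : Type) [TopologicalSpace X] (A : Set X) : ℝ :=
  ∑ᶠ c : ConnectedComponents X,
    simVolConn n {x : X // ConnectedComponents.mk x = c} {x | ↑x ∈ A}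

/-- Rational simplicial volume (for orientable manifolds). -/
def SimVolQ (n : ℕ) (X : Type) [TopologicalSpace X] (A : Set X) : ℝ :=
  ∑ᶠ c : ConnectedComponents X,
    simVolOrQ n {x : X // ConnectedComponents.mk x = c} {x | ↑x ∈ A}

/-! ## Topological manifolds with boundary -/

/-- `X` is a topological `n`-manifold, possibly with boundary. -/
def IsManifoldWithBoundary (n : ℕ) (X : Type) [TopologicalSpace X] : Prop :=
  T2Space X ∧ SecondCountableTopology X ∧ ∀ x : X, ∃ U : Set X, x ∈ U ∧ IsOpen U ∧
    (Nonempty (U ≃ₜ EuclideanSpace ℝ (Fin n)) ∨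
      Nonempty (U ≃ₜ {y : EuclideanSpace ℝ (Fin n) // 0 ≤ ∑ i, y i}))

/-- The boundary of a topological `n`-manifold: the points having no neighbourhood
homeomorphic to `ℝⁿ`. -/
def intBoundary (n : ℕ) (X : Type) [TopologicalSpace X] : Set X :=
  {x | ¬ ∃ U : Set X, x ∈ U ∧ IsOpen U ∧ Nonempty (U ≃ₜ EuclideanSpace ℝ (Fin n))}

/-! ## Pseudomanifolds associated to integral cycles -/

section Pseudomanifolds

/-- Two distinct (simplex, face)-flags form a canceling pair for the family of singular
simplices `σ` with signs `eps`: the corresponding faces coincide as singular simplices and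
their induced signs cancel. -/
def Cancelling (n : ℕ) {X : Type} [TopologicalSpace X] {N : ℕ}
    (σ : Fin N → SingSimplex n X) (eps : Fin N → ℤ)
    (a b : Fin N × Fin (n + 1)) : Prop :=
  a ≠ b ∧ faceOf n a.2 (σ a.1) = faceOf n b.2 (σ b.1) ∧
    ((-1 : ℤ) ^ (a.2 : ℕ)) * eps a.1 + ((-1 : ℤ) ^ (b.2 : ℕ)) * eps b.1 = 0

/-- A pseudomanifold associated to the integral cycle `∑ i, eps i • σ i`: the
`(n-1)`-dimensional faces of `N` copies of the standard `n`-simplex are identified along a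
maximal family of canceling pairs. -/
structure AssocPseudomanifold (n : ℕ) {X : Type} [TopologicalSpace X] {N : ℕ}
    (eps : Fin N → ℤ) (σ : Fin N → SingSimplex n X) where
  pair : Fin N × Fin (n + 1) → Option (Fin N × Fin (n + 1))
  symm : ∀ a b, pair a = some b → pair b = some a
  cancel : ∀ a b, pair a = some b → Cancelling n σ eps a b
  maximal : ∀ a b, pair a = none → pair b = none → ¬ Cancelling n σ eps a b

/-- The dual graph of an associated pseudomanifold: vertices are the top-dimensional
simplices, edges are the pairs of identified faces.  The pseudomanifold is connected if and
only if its dual graph is. -/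
def dualGraph {n : ℕ} {X : Type} [TopologicalSpace X] {N : ℕ}
    {eps : Fin N → ℤ} {σ : Fin N → SingSimplex n X}
    (P : AssocPseudomanifold n eps σ) : SimpleGraph (Fin N) :=
  SimpleGraph.fromRel fun i i' => ∃ j j', P.pair (i, j) = some (i', j')

end Pseudomanifolds


/-! ## Simplices and the boundary operator -/

lemma TSimplex.ext' {n : ℕ} {x y : TSimplex n} (h : ∀ i, x.1 i = y.1 i) : x = y :=
  Subtype.ext (funext h)

instance tsimplexCompact (n : ℕ) : CompactSpace (TSimplex n) :=
  isCompact_iff_compactSpace.mp (isCompact_stdSimplex ℝ (Fin (n + 1)))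

instance tsimplexT2 (n : ℕ) : T2Space (TSimplex n) :=
  inferInstanceAs (T2Space {x : Fin (n + 1) → ℝ // (∀ i, 0 ≤ x i) ∧ ∑ i, x i = 1})

/-- affine map induced by a vertex map -/
def affMap {a b : ℕ} (f : Fin (a + 1) → Fin (b + 1)) : C(TSimplex a, TSimplex b) where
  toFun x := ⟨fun j => ∑ k ∈ Finset.univ.filter (fun k => f k = j), x.1 k, by
    constructor
    · intro j
      exact Finset.sum_nonneg fun k _ => x.2.1 k
    · rw [Finset.sum_fiberwise_of_maps_to (fun k _ => Finset.mem_univ (f k)), x.2.2]⟩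
  continuous_toFun := by
    apply Continuous.subtype_mk
    exact continuous_pi fun j => continuous_finsetSum _ fun k _ =>
      (continuous_apply k).comp continuous_subtype_val

lemma faceMap_eq_affMap {n : ℕ} (i : Fin (n + 2)) :
    (faceMap i : C(TSimplex n, TSimplex (n + 1))) = affMap i.succAbove := rfl

lemma affMap_comp {a b c : ℕ} (g : Fin (b + 1) → Fin (c + 1)) (f : Fin (a + 1) → Fin (b + 1)) :
    (affMap g).comp (affMap f) = affMap (g ∘ f) := by
  ext x
  apply TSimplex.ext'
  intro j
  change ∑ k ∈ Finset.univ.filter (fun k => g k = j),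
      ∑ l ∈ Finset.univ.filter (fun l => f l = k), x.1 l
    = ∑ l ∈ Finset.univ.filter (fun l => g (f l) = j), x.1 l
  simp only [Finset.sum_filter]
  have : ∀ k, (if g k = j then ∑ l, (if f l = k then x.1 l else 0) else 0)
      = ∑ l, (if f l = k then (if g k = j then x.1 l else 0) else 0) := by
    intro k
    split_ifs <;> simp
  simp only [this]
  rw [Finset.sum_comm]
  simp

lemma affMap_id {a : ℕ} : affMap (id : Fin (a + 1) → Fin (a + 1)) = ContinuousMap.id _ := by
  ext x
  apply TSimplex.ext'
  intro j
  change ∑ k ∈ Finset.univ.filter (fun k => id k = j), x.1 k = x.1 j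
  simp [Finset.sum_filter]

lemma faceMap_self {n : ℕ} (i : Fin (n + 2)) (x : TSimplex n) : (faceMap i x).1 i = 0 := by
  change ∑ k ∈ Finset.univ.filter (fun k => i.succAbove k = i), x.1 k = 0
  simp [Fin.succAbove_ne]

lemma faceMap_succAbove {n : ℕ} (i : Fin (n + 2)) (x : TSimplex n) (k : Fin (n + 1)) :
    (faceMap i x).1 (i.succAbove k) = x.1 k := by
  change ∑ l ∈ Finset.univ.filter (fun l => i.succAbove l = i.succAbove k), x.1 l = _
  simp [Finset.sum_filter]

lemma exists_faceMap {n : ℕ} (i : Fin (n + 2)) (x : TSimplex (n + 1)) (h : x.1 i = 0) :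
    ∃ y, faceMap i y = x := by
  refine ⟨⟨fun k => x.1 (i.succAbove k), fun k => x.2.1 _, ?_⟩, ?_⟩
  · have := x.2.2
    rw [Fin.sum_univ_succAbove _ i, h, zero_add] at this
    exact this
  · apply TSimplex.ext'
    intro j
    rcases Fin.eq_self_or_eq_succAbove i j with rfl | ⟨k, rfl⟩
    · exact (faceMap_self _ _).trans h.symm
    · exact faceMap_succAbove _ _ _

section chains
variable {R : Type} [CommRing R] {X Y : Type} [TopologicalSpace X] [TopologicalSpace Y]

lemma sbdry_single {n : ℕ} (σ : SingSimplex (n + 1) X) (a : R) :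
    sbdry R (Finsupp.single σ a)
      = ∑ i : Fin (n + 2), ((-1 : ℤ) ^ (i : ℕ)) • Finsupp.single (σ.comp (faceMap i)) a := by
  unfold sbdry
  rw [Finsupp.lsum_single, LinearMap.toSpanSingleton_apply, Finset.smul_sum]
  refine Finset.sum_congr rfl fun i _ => ?_
  rw [smul_comm, Finsupp.smul_single, smul_eq_mul, mul_one]

lemma face_face {n : ℕ} (i : Fin (n + 3)) (j : Fin (n + 2)) :
    (faceMap i).comp (faceMap j)
      = (faceMap (i.succAbove j)).comp (faceMap (j.predAbove i)) := by
  simp only [faceMap_eq_affMap, affMap_comp]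
  congr 1
  ext k
  simp [Fin.succAbove_succAbove_succAbove_predAbove]

lemma sbdry_sbdry {n : ℕ} (z : SChain R (n + 2) X) : sbdry R (sbdry R z) = 0 := by
  induction z using Finsupp.induction_linear with
  | zero => simp
  | add f g hf hg => rw [map_add, map_add, hf, hg, add_zero]
  | single σ a =>
    rw [sbdry_single, map_sum]
    simp only [map_zsmul, sbdry_single, Finset.smul_sum]
    rw [← Finset.sum_product']
    refine Finset.sum_involution (fun p _ => (p.1.succAbove p.2, p.2.predAbove p.1)) ?_ ?_ ?_ ?_
    · rintro ⟨i, j⟩ _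
      simp only [smul_smul]
      rw [ContinuousMap.comp_assoc, ContinuousMap.comp_assoc, face_face i j, ← add_smul]
      refine smul_eq_zero_of_left ?_ _
      rw [← pow_add, ← pow_add]
      rcases lt_or_ge j.castSucc i with h | h
      · rw [Fin.succAbove_of_castSucc_lt _ _ h, Fin.predAbove_of_castSucc_lt _ _ h]
        have : (i : ℕ) = (i.pred (Fin.ne_zero_of_lt h) : ℕ) + 1 := by
          simp only [Fin.val_pred]; have := Fin.lt_def.1 h; omega
        rw [this, Fin.val_castSucc]
        ring
      · rw [Fin.succAbove_of_le_castSucc _ _ h, Fin.predAbove_of_le_castSucc _ _ h]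
        simp only [Fin.val_succ, Fin.coe_castPred]
        ring
    · rintro ⟨i, j⟩ _ _ h
      have := congrArg Prod.fst h
      exact Fin.succAbove_ne _ _ this
    · intros; exact Finset.mem_univ _
    · rintro ⟨i, j⟩ _
      exact Prod.ext (Fin.succAbove_succAbove_predAbove _ _) (Fin.predAbove_predAbove_succAbove _ _)

/-- pushforward of chains -/
def push (R : Type) [CommRing R] {X Y : Type} [TopologicalSpace X] [TopologicalSpace Y]
    (f : C(X, Y)) (n : ℕ) : SChain R n X →ₗ[R] SChain R n Y :=
  Finsupp.lmapDomain R R (fun σ : SingSimplex n X => f.comp σ)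

lemma push_single (f : C(X, Y)) {n : ℕ} (σ : SingSimplex n X) (a : R) :
    push R f n (Finsupp.single σ a) = Finsupp.single (f.comp σ) a := by
  simp [push]

lemma sbdry_push (f : C(X, Y)) {n : ℕ} (z : SChain R (n + 1) X) :
    sbdry R (push R f (n + 1) z) = push R f n (sbdry R z) := by
  induction z using Finsupp.induction_linear with
  | zero => simp
  | add a b ha hb => rw [map_add, map_add, map_add, map_add, ha, hb]
  | single σ a =>
    simp only [push_single, sbdry_single, map_sum, map_zsmul, ContinuousMap.comp_assoc]

lemma single_mem_suppOn {n : ℕ} {A : Set X} {σ : SingSimplex n X} (h : Set.range σ ⊆ A) (a : R) :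
    (Finsupp.single σ a : SChain R n X) ∈ suppOn R n A :=
  Finsupp.single_mem_supported R a h

lemma suppOn_induction {n : ℕ} {A : Set X} {z : SChain R n X} (hz : z ∈ suppOn R n A)
    (S : AddSubgroup (SChain R n X))
    (h : ∀ σ : SingSimplex n X, Set.range σ ⊆ A → ∀ a : R, Finsupp.single σ a ∈ S) : z ∈ S := by
  rw [← Finsupp.sum_single z]
  refine S.sum_mem fun σ hσ => h σ ?_ _
  exact hz hσ

lemma sbdry_suppOn {n : ℕ} {A : Set X} {z : SChain R (n + 1) X} (hz : z ∈ suppOn R (n + 1) A) :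
    sbdry R z ∈ suppOn R n A := by
  refine suppOn_induction hz ((suppOn R n A).toAddSubgroup.comap (sbdry R).toAddMonoidHom) ?_
  intro σ hσ a
  change sbdry R (Finsupp.single σ a) ∈ suppOn R n A
  rw [sbdry_single]
  refine Submodule.sum_mem _ fun i _ => zsmul_mem (single_mem_suppOn ?_ a) _
  rintro _ ⟨x, rfl⟩
  exact hσ ⟨_, rfl⟩

lemma push_suppOn {n : ℕ} {A : Set X} {B : Set Y} (f : C(X, Y)) (hf : ∀ x ∈ A, f x ∈ B)
    {z : SChain R n X} (hz : z ∈ suppOn R n A) : push R f n z ∈ suppOn R n B := by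
  refine suppOn_induction hz ((suppOn R n B).toAddSubgroup.comap (push R f n).toAddMonoidHom) ?_
  intro σ hσ a
  change push R f n (Finsupp.single σ a) ∈ suppOn R n B
  rw [push_single]
  refine single_mem_suppOn ?_ a
  rintro _ ⟨x, rfl⟩
  exact hf _ (hσ ⟨_, rfl⟩)

lemma push_push {Z : Type} [TopologicalSpace Z] (f : C(X, Y)) (g : C(Y, Z)) (n : ℕ)
    (z : SChain R n X) : push R g n (push R f n z) = push R (g.comp f) n z := by
  induction z using Finsupp.induction_linear with
  | zero => simp
  | add a b ha hb => simp only [map_add, ha, hb]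
  | single σ a => simp only [push_single, ContinuousMap.comp_assoc]

lemma push_id (n : ℕ) (z : SChain R n X) : push R (ContinuousMap.id X) n z = z := by
  induction z using Finsupp.induction_linear with
  | zero => simp
  | add a b ha hb => simp only [map_add, ha, hb]
  | single σ a => simp only [push_single, ContinuousMap.id_comp]

end chains

/-- relative boundaries -/
def Bdr (R : Type) [CommRing R] (n : ℕ) {X : Type} [TopologicalSpace X] (A : Set X) :
    Submodule R (SChain R n X) :=
  LinearMap.range (sbdry R : SChain R (n + 1) X →ₗ[R] SChain R n X) ⊔ suppOn R n A

section
variable {R : Type} [CommRing R] {X Y : Type} [TopologicalSpace X] [TopologicalSpace Y]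

lemma relHomologous_iff {n : ℕ} {A : Set X} {z z' : SChain R n X} :
    RelHomologous R n A z z' ↔ z - z' ∈ Bdr R n A := by
  unfold RelHomologous Bdr
  rw [Submodule.mem_sup]
  constructor
  · rintro ⟨w, hw⟩
    exact ⟨_, ⟨w, rfl⟩, _, hw, by abel⟩
  · rintro ⟨_, ⟨w, rfl⟩, y, hy, h⟩
    exact ⟨w, by rw [← h]; simpa using hy⟩

lemma suppOn_le_Bdr {n : ℕ} {A : Set X} : suppOn R n A ≤ Bdr R n A := le_sup_right

lemma sbdry_mem_Bdr {n : ℕ} {A : Set X} (w : SChain R (n + 1) X) : sbdry R w ∈ Bdr R n A :=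
  (le_sup_left : _ ≤ Bdr R n A) ⟨w, rfl⟩

lemma sbdry_of_mem_Bdr {n : ℕ} {A : Set X} {z : SChain R (n + 1) X} (h : z ∈ Bdr R (n + 1) A) :
    sbdry R z ∈ suppOn R n A := by
  unfold Bdr at h
  rw [Submodule.mem_sup] at h
  obtain ⟨_, ⟨w, rfl⟩, y, hy, rfl⟩ := h
  rw [map_add, sbdry_sbdry, zero_add]
  exact sbdry_suppOn hy

lemma push_Bdr {n : ℕ} {A : Set X} {B : Set Y} (f : C(X, Y)) (hf : ∀ x ∈ A, f x ∈ B)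
    {z : SChain R n X} (h : z ∈ Bdr R n A) : push R f n z ∈ Bdr R n B := by
  unfold Bdr at h
  rw [Submodule.mem_sup] at h
  obtain ⟨_, ⟨w, rfl⟩, y, hy, rfl⟩ := h
  rw [map_add, ← sbdry_push]
  exact add_mem (sbdry_mem_Bdr _) (suppOn_le_Bdr (push_suppOn f hf hy))

end

/-! ## Cones -/

/-- the join map presenting the simplex as a quotient of a product -/
def joinMap (k : ℕ) : C(TSimplex k × unitInterval, TSimplex (k + 1)) where
  toFun p := ⟨Fin.cons (p.2 : ℝ) (fun i => (1 - (p.2 : ℝ)) * p.1.1 i), by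
    constructor
    · intro i
      refine Fin.cases ?_ (fun j => ?_) i
      · simpa using p.2.2.1
      · simpa using mul_nonneg (sub_nonneg.2 p.2.2.2) (p.1.2.1 j)
    · rw [Fin.sum_univ_succ]
      simp only [Fin.cons_zero, Fin.cons_succ]
      rw [← Finset.mul_sum, p.1.2.2]; ring⟩
  continuous_toFun := by
    apply Continuous.subtype_mk
    apply continuous_pi
    intro i
    refine Fin.cases ?_ (fun j => ?_) i
    · simp only [Fin.cons_zero]; fun_prop
    · simp only [Fin.cons_succ]
      refine Continuous.mul (by fun_prop) ?_
      exact (continuous_apply j).comp (continuous_subtype_val.comp continuous_fst)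

lemma joinMap_zero {k : ℕ} (y : TSimplex k) (t : unitInterval) :
    (joinMap k (y, t)).1 0 = t := rfl

lemma joinMap_succ {k : ℕ} (y : TSimplex k) (t : unitInterval) (i : Fin (k + 1)) :
    (joinMap k (y, t)).1 i.succ = (1 - (t : ℝ)) * y.1 i := rfl

lemma joinMap_surj (k : ℕ) : Function.Surjective (joinMap k) := by
  intro x
  have hle : x.1 0 ≤ 1 := by
    have h1 := Finset.single_le_sum (fun i _ => x.2.1 i) (Finset.mem_univ 0)
    exact h1.trans x.2.2.le
  have hs : x.1 0 + ∑ i : Fin (k + 1), x.1 i.succ = 1 := by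
    rw [← Fin.sum_univ_succ]; exact x.2.2
  by_cases h : x.1 0 = 1
  · have hz : ∀ i : Fin (k + 1), x.1 i.succ = 0 := by
      have h0 : ∑ i : Fin (k + 1), x.1 i.succ = 0 := by linarith
      intro i
      exact (Finset.sum_eq_zero_iff_of_nonneg (fun i _ => x.2.1 _)).1 h0 i (Finset.mem_univ _)
    refine ⟨(vertexPt 0, ⟨x.1 0, x.2.1 0, hle⟩), ?_⟩
    apply TSimplex.ext'
    intro i
    refine Fin.cases ?_ (fun j => ?_) i
    · rw [joinMap_zero]
    · rw [joinMap_succ, hz]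
      change (1 - x.1 0) * _ = 0
      rw [h]; ring
  · have hpos : 0 < 1 - x.1 0 := by
      rcases lt_or_eq_of_le hle with h' | h'
      · linarith
      · exact absurd h' h
    refine ⟨(⟨fun i => x.1 i.succ / (1 - x.1 0), fun i => div_nonneg (x.2.1 _) hpos.le, ?_⟩,
      ⟨x.1 0, x.2.1 0, hle⟩), ?_⟩
    · rw [← Finset.sum_div, div_eq_one_iff_eq hpos.ne']
      linarith
    · apply TSimplex.ext'
      intro i
      refine Fin.cases ?_ (fun j => ?_) i
      · rfl
      · change (1 - x.1 0) * (x.1 j.succ / (1 - x.1 0)) = _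
        field_simp

lemma joinMap_quot (k : ℕ) : Topology.IsQuotientMap (joinMap k) :=
  (joinMap k).continuous.isClosedMap.isQuotientMap (joinMap k).continuous (joinMap_surj k)

lemma faceMap_zero_join {k : ℕ} (y : TSimplex k) : faceMap 0 y = joinMap k (y, 0) := by
  apply TSimplex.ext'
  intro i
  refine Fin.cases ?_ (fun j => ?_) i
  · rw [faceMap_self, joinMap_zero]; rfl
  · rw [joinMap_succ]
    have := faceMap_succAbove 0 y j
    rw [Fin.succAbove_zero] at this
    rw [this]; simp

lemma faceMap_succ_join {k : ℕ} (i : Fin (k + 2)) (y : TSimplex k) (t : unitInterval) :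
    faceMap i.succ (joinMap k (y, t)) = joinMap (k + 1) (faceMap i y, t) := by
  apply TSimplex.ext'
  intro j
  rcases Fin.eq_self_or_eq_succAbove i.succ j with rfl | ⟨l, rfl⟩
  · rw [faceMap_self, joinMap_succ, faceMap_self, mul_zero]
  · rw [faceMap_succAbove]
    refine Fin.cases ?_ (fun m => ?_) l
    · rw [Fin.succ_succAbove_zero, joinMap_zero, joinMap_zero]
    · rw [Fin.succ_succAbove_succ, joinMap_succ, joinMap_succ, faceMap_succAbove]

section cone
variable {E : Type} [AddCommGroup E] [Module ℝ E] [TopologicalSpace E]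
  [IsTopologicalAddGroup E] [ContinuousSMul ℝ E] {D : Set E} {q : E}

/-- the map whose descent is the cone -/
def preCone (hD : StarConvex ℝ q D) {k : ℕ} (σ : SingSimplex k D) :
    C(TSimplex k × unitInterval, D) where
  toFun p := ⟨(p.2 : ℝ) • q + (1 - (p.2 : ℝ)) • (σ p.1 : E),
    hD (σ p.1).2 p.2.2.1 (sub_nonneg.2 p.2.2.2) (by ring)⟩
  continuous_toFun := by
    apply Continuous.subtype_mk
    fun_prop

lemma preCone_factors (hD : StarConvex ℝ q D) {k : ℕ} (σ : SingSimplex k D) :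
    Function.FactorsThrough (preCone hD σ) (joinMap k) := by
  rintro ⟨y, t⟩ ⟨y', t'⟩ h
  have h0 : t = t' := by
    have := congrArg (fun x : TSimplex (k + 1) => x.1 0) h
    exact Subtype.ext this
  subst h0
  apply Subtype.ext
  change (t : ℝ) • q + (1 - (t : ℝ)) • (σ y : E) = (t : ℝ) • q + (1 - (t : ℝ)) • (σ y' : E)
  by_cases ht : (1 - (t : ℝ)) = 0
  · rw [ht]; simp
  · have : y = y' := by
      apply TSimplex.ext'
      intro i
      have := congrArg (fun x : TSimplex (k + 1) => x.1 i.succ) h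
      exact mul_left_cancel₀ ht this
    rw [this]

/-- cone of a singular simplex -/
def coneS (hD : StarConvex ℝ q D) {k : ℕ} (σ : SingSimplex k D) : SingSimplex (k + 1) D :=
  (joinMap_quot k).lift (preCone hD σ) (preCone_factors hD σ)

lemma coneS_join (hD : StarConvex ℝ q D) {k : ℕ} (σ : SingSimplex k D) (p) :
    coneS hD σ (joinMap k p) = preCone hD σ p := by
  have := (joinMap_quot k).lift_comp (preCone hD σ) (preCone_factors hD σ)
  exact DFunLike.congr_fun this p

lemma coneS_face_zero (hD : StarConvex ℝ q D) {k : ℕ} (σ : SingSimplex k D) :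
    (coneS hD σ).comp (faceMap 0) = σ := by
  ext y
  rw [ContinuousMap.comp_apply, faceMap_zero_join, coneS_join]
  change ((0 : unitInterval) : ℝ) • q + (1 - ((0 : unitInterval) : ℝ)) • (σ y : E) = _
  simp

lemma coneS_face_succ (hD : StarConvex ℝ q D) {k : ℕ} (σ : SingSimplex (k + 1) D)
    (i : Fin (k + 2)) :
    (coneS hD σ).comp (faceMap i.succ) = coneS hD (σ.comp (faceMap i)) := by
  apply ContinuousMap.ext
  intro x
  obtain ⟨⟨y, t⟩, rfl⟩ := joinMap_surj k x
  rw [ContinuousMap.comp_apply, faceMap_succ_join, coneS_join, coneS_join]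
  rfl

lemma coneS_apex (hD : StarConvex ℝ q D) {k : ℕ} (σ : SingSimplex k D) :
    ∃ x, (coneS hD σ x : E) = q := by
  refine ⟨joinMap k (vertexPt 0, 1), ?_⟩
  rw [coneS_join]
  change ((1 : unitInterval) : ℝ) • q + (1 - ((1 : unitInterval) : ℝ)) • (_ : E) = _
  simp

lemma coneS_range (hD : StarConvex ℝ q D) {Q : Set E} (hQ : StarConvex ℝ q Q) {k : ℕ}
    (σ : SingSimplex k D) (h : ∀ x, (σ x : E) ∈ Q) (x) : (coneS hD σ x : E) ∈ Q := by
  obtain ⟨⟨y, t⟩, rfl⟩ := joinMap_surj k x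
  rw [coneS_join]
  exact hQ (h y) t.2.1 (sub_nonneg.2 t.2.2) (by ring)

/-- cone operator on chains -/
def coneC (hD : StarConvex ℝ q D) (k : ℕ) : SChain ℤ k D →ₗ[ℤ] SChain ℤ (k + 1) D :=
  Finsupp.lmapDomain ℤ ℤ (coneS hD)

lemma coneC_single (hD : StarConvex ℝ q D) {k : ℕ} (σ : SingSimplex k D) (a : ℤ) :
    coneC hD k (Finsupp.single σ a) = Finsupp.single (coneS hD σ) a := by
  simp [coneC]

lemma sbdry_coneC (hD : StarConvex ℝ q D) {k : ℕ} (z : SChain ℤ (k + 1) D) :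
    sbdry ℤ (coneC hD (k + 1) z) = z - coneC hD k (sbdry ℤ z) := by
  induction z using Finsupp.induction_linear with
  | zero => simp
  | add a b ha hb => simp only [map_add, ha, hb]; abel
  | single σ a =>
    rw [coneC_single, sbdry_single, sbdry_single, Fin.sum_univ_succ, map_sum]
    simp only [map_zsmul, coneC_single, coneS_face_zero, coneS_face_succ]
    simp only [Fin.val_zero, pow_zero, one_smul, Fin.val_succ, pow_succ, mul_neg, mul_one,
      neg_smul, Finset.sum_neg_distrib]
    abel

lemma coneC_suppOn (hD : StarConvex ℝ q D) {Q : Set E} (hQ : StarConvex ℝ q Q) {k : ℕ}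
    {z : SChain ℤ k D} (hz : z ∈ suppOn ℤ k {x : D | (x : E) ∈ Q}) :
    coneC hD k z ∈ suppOn ℤ (k + 1) {x : D | (x : E) ∈ Q} := by
  refine suppOn_induction hz
    ((suppOn ℤ (k + 1) {x : D | (x : E) ∈ Q}).toAddSubgroup.comap
      (coneC hD k).toAddMonoidHom) ?_
  intro σ hσ a
  change coneC hD k (Finsupp.single σ a) ∈ suppOn ℤ (k + 1) _
  rw [coneC_single]
  refine single_mem_suppOn ?_ a
  rintro _ ⟨x, rfl⟩
  exact coneS_range hD hQ σ (fun y => hσ ⟨y, rfl⟩) x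

/-- a chain in a star-shaped model whose boundary lies in a star-shaped part is trivial -/
lemma model_lemma {M : Type} [TopologicalSpace M] {A : Set M}
    (hD : StarConvex ℝ q D) {Q : Set E} (hQ : StarConvex ℝ q Q) (F : C(D, M))
    (hF : ∀ x : D, (x : E) ∈ Q → F x ∈ A) {m : ℕ} (x : SChain ℤ (m + 2) D)
    (hx : sbdry ℤ x ∈ suppOn ℤ (m + 1) {x : D | (x : E) ∈ Q}) :
    push ℤ F (m + 2) x ∈ Bdr ℤ (m + 2) A := by
  have h1 := sbdry_coneC hD (sbdry ℤ x)
  rw [sbdry_sbdry, map_zero, sub_zero] at h1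
  have h2 := sbdry_coneC hD (x - coneC hD _ (sbdry ℤ x))
  have h0 : sbdry ℤ (x - coneC hD _ (sbdry ℤ x)) = 0 := by rw [map_sub, h1, sub_self]
  rw [h0, map_zero, sub_zero] at h2
  have h3 : x = sbdry ℤ (coneC hD (m + 2) (x - coneC hD _ (sbdry ℤ x)))
      + coneC hD _ (sbdry ℤ x) := by rw [h2]; abel
  rw [h3, map_add, ← sbdry_push]
  exact add_mem (sbdry_mem_Bdr _) (suppOn_le_Bdr (push_suppOn F hF (coneC_suppOn hD hQ hx)))

end cone

/-! ## Gluing two simplices along a face -/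

/-- bipyramid -/
def bipyr (m : ℕ) : Set ((Fin (m + 2) → ℝ) × ℝ) :=
  {p | ∑ i, p.1 i + p.2 = 1 ∧ (∀ i, 0 ≤ p.1 i) ∧ ∀ i, 0 ≤ ((m : ℝ) + 2) * p.1 i + 2 * p.2}

/-- the part of the boundary of the bipyramid adjacent to the second apex -/
def bipyrQ (m : ℕ) : Set ((Fin (m + 2) → ℝ) × ℝ) :=
  {p | p ∈ bipyr m ∧ ∃ i, ((m : ℝ) + 2) * p.1 i + 2 * p.2 = 0}

/-- second apex -/
def apex (m : ℕ) : (Fin (m + 2) → ℝ) × ℝ := (fun _ => 2 / ((m : ℝ) + 2), -1)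

lemma bipyr_star (m : ℕ) : StarConvex ℝ (apex m) (bipyr m) := by
  rintro ⟨y, u⟩ ⟨h1, h2, h3⟩ a b ha hb hab
  have hN : (0 : ℝ) < (m : ℝ) + 2 := by positivity
  refine ⟨?_, ?_, ?_⟩
  · simp only [apex, Prod.fst_add, Prod.smul_fst, Pi.add_apply, Pi.smul_apply, smul_eq_mul,
      Prod.snd_add, Prod.smul_snd, Finset.sum_add_distrib, ← Finset.mul_sum]
    simp only [Finset.sum_const, Finset.card_univ, Fintype.card_fin, nsmul_eq_mul]
    push_cast
    have e : ((m : ℝ) + 2) * (2 / ((m : ℝ) + 2)) = 2 := by field_simp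
    rw [e]
    simp only at h1
    calc _ = a + b * (∑ i, y i + u) := by ring
      _ = 1 := by rw [h1, mul_one, hab]
  · intro i
    simp only [apex, Prod.fst_add, Prod.smul_fst, Pi.add_apply, Pi.smul_apply, smul_eq_mul]
    have := h2 i
    simp only at this
    positivity
  · intro i
    simp only [apex, Prod.fst_add, Prod.smul_fst, Pi.add_apply, Pi.smul_apply, smul_eq_mul,
      Prod.snd_add, Prod.smul_snd]
    have := mul_nonneg hb (h3 i)
    simp only at this
    have e : ((m : ℝ) + 2) * (a * (2 / ((m : ℝ) + 2)) + b * y i) + 2 * (a * -1 + b * u)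
        = b * (((m : ℝ) + 2) * y i + 2 * u) := by field_simp; ring
    rw [e]; exact this

lemma bipyrQ_star (m : ℕ) : StarConvex ℝ (apex m) (bipyrQ m) := by
  rintro ⟨y, u⟩ ⟨h, i, hi⟩ a b ha hb hab
  refine ⟨bipyr_star m h ha hb hab, i, ?_⟩
  have hN : (0 : ℝ) < (m : ℝ) + 2 := by positivity
  simp only [apex, Prod.fst_add, Prod.smul_fst, Pi.add_apply, Pi.smul_apply, smul_eq_mul,
      Prod.snd_add, Prod.smul_snd]
  simp only at hi
  have e : ((m : ℝ) + 2) * (a * (2 / ((m : ℝ) + 2)) + b * y i) + 2 * (a * -1 + b * u)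
        = b * (((m : ℝ) + 2) * y i + 2 * u) := by field_simp; ring
  rw [e, hi, mul_zero]

/-- folding map -/
def foldIns {m : ℕ} (j : Fin (m + 3)) : C(bipyr m, TSimplex (m + 2)) where
  toFun p := ⟨j.insertNth (α := fun _ => ℝ) |p.1.2|
      (fun i => p.1.1 i + 2 / ((m : ℝ) + 2) * min p.1.2 0), by
    obtain ⟨⟨y, u⟩, h1, h2, h3⟩ := p
    have hN : (0 : ℝ) < (m : ℝ) + 2 := by positivity
    simp only at h1 h2 h3 ⊢
    constructor
    · intro i
      rcases Fin.eq_self_or_eq_succAbove j i with rfl | ⟨k, rfl⟩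
      · simp
      · rw [Fin.insertNth_apply_succAbove]
        rcases le_total 0 u with h | h
        · rw [min_eq_right h]; simpa using h2 k
        · rw [min_eq_left h]
          have := h3 k
          have e : y k + 2 / ((m : ℝ) + 2) * u = (((m : ℝ) + 2) * y k + 2 * u) / ((m : ℝ) + 2) := by
            field_simp
          rw [e]; positivity
    · rw [Fin.sum_univ_succAbove _ j]
      simp only [Fin.insertNth_apply_same, Fin.insertNth_apply_succAbove, Finset.sum_add_distrib,
        Finset.sum_const, Finset.card_univ, Fintype.card_fin, nsmul_eq_mul]
      push_cast
      have e : ((m : ℝ) + 2) * (2 / ((m : ℝ) + 2) * min u 0) = 2 * min u 0 := by field_simp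
      rw [e]
      rcases le_total 0 u with h | h
      · rw [min_eq_right h, abs_of_nonneg h]; linarith
      · rw [min_eq_left h, abs_of_nonpos h]; linarith⟩
  continuous_toFun := by
    apply Continuous.subtype_mk
    apply continuous_pi
    intro i
    rcases Fin.eq_self_or_eq_succAbove j i with rfl | ⟨k, rfl⟩
    · simp only [Fin.insertNth_apply_same]; fun_prop
    · simp only [Fin.insertNth_apply_succAbove]; fun_prop

lemma foldIns_self {m : ℕ} (j : Fin (m + 3)) (p : bipyr m) : (foldIns j p).1 j = |p.1.2| :=
  Fin.insertNth_apply_same (α := fun _ => ℝ) j |p.1.2|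
    (fun i => p.1.1 i + 2 / ((m : ℝ) + 2) * min p.1.2 0)

lemma foldIns_succAbove {m : ℕ} (j : Fin (m + 3)) (p : bipyr m) (k : Fin (m + 2)) :
    (foldIns j p).1 (j.succAbove k) = p.1.1 k + 2 / ((m : ℝ) + 2) * min p.1.2 0 :=
  Fin.insertNth_apply_succAbove (α := fun _ => ℝ) j |p.1.2|
    (fun i => p.1.1 i + 2 / ((m : ℝ) + 2) * min p.1.2 0) k

lemma foldIns_face {m : ℕ} (p : bipyr m) (h : p.1.2 = 0) :
    ∃ y, ∀ j : Fin (m + 3), foldIns j p = faceMap j y := by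
  obtain ⟨y, hy⟩ := exists_faceMap 0 (foldIns 0 p) (by rw [foldIns_self, h, abs_zero])
  refine ⟨y, fun j => ?_⟩
  apply TSimplex.ext'
  intro i
  rcases Fin.eq_self_or_eq_succAbove j i with rfl | ⟨k, rfl⟩
  · rw [foldIns_self, faceMap_self, h, abs_zero]
  · rw [foldIns_succAbove, faceMap_succAbove, ← faceMap_succAbove 0 y k, hy, foldIns_succAbove]

section
variable {M : Type} [TopologicalSpace M]

/-- the map on the bipyramid -/
def bipyrF {m : ℕ} (σ σ' : SingSimplex (m + 2) M) (j j' : Fin (m + 3))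
    (h : σ.comp (faceMap j) = σ'.comp (faceMap j')) : C(bipyr m, M) where
  toFun p := open Classical in if 0 ≤ p.1.2 then σ' (foldIns j' p) else σ (foldIns j p)
  continuous_toFun := by
    refine Continuous.if_le (by fun_prop) (by fun_prop) (by fun_prop) (by fun_prop) ?_
    intro p hp
    obtain ⟨y, hy⟩ := foldIns_face p hp.symm
    rw [hy, hy]
    exact (DFunLike.congr_fun h y).symm

lemma bipyrF_pos {m : ℕ} (σ σ' : SingSimplex (m + 2) M) (j j' : Fin (m + 3))
    (h : σ.comp (faceMap j) = σ'.comp (faceMap j')) (p : bipyr m) (hp : 0 ≤ p.1.2) :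
    bipyrF σ σ' j j' h p = σ' (foldIns j' p) := by
  change (open Classical in if 0 ≤ p.1.2 then σ' (foldIns j' p) else σ (foldIns j p)) = _
  rw [if_pos hp]

lemma bipyrF_neg {m : ℕ} (σ σ' : SingSimplex (m + 2) M) (j j' : Fin (m + 3))
    (h : σ.comp (faceMap j) = σ'.comp (faceMap j')) (p : bipyr m) (hp : p.1.2 ≤ 0) :
    bipyrF σ σ' j j' h p = σ (foldIns j p) := by
  rcases lt_or_eq_of_le hp with h' | h'
  · change (open Classical in if 0 ≤ p.1.2 then σ' (foldIns j' p) else σ (foldIns j p)) = _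
    rw [if_neg (not_le.2 h')]
  · rw [bipyrF_pos _ _ _ _ _ _ h'.ge]
    obtain ⟨y, hy⟩ := foldIns_face p h'
    rw [hy, hy]
    exact (DFunLike.congr_fun h y).symm

/-- the positive simplex -/
def sPos {m : ℕ} (j' : Fin (m + 3)) : SingSimplex (m + 2) (bipyr m) where
  toFun x := ⟨(fun i => x.1 (j'.succAbove i), x.1 j'), by
    have h := x.2.2
    rw [Fin.sum_univ_succAbove _ j'] at h
    refine ⟨?_, fun i => x.2.1 _, fun i => ?_⟩
    · simp only; linarith
    · have h1 := x.2.1 (j'.succAbove i)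
      have h2 := x.2.1 j'
      simp only
      positivity⟩
  continuous_toFun := by
    apply Continuous.subtype_mk
    exact Continuous.prodMk
      (continuous_pi fun i => (continuous_apply _).comp continuous_subtype_val)
      ((continuous_apply _).comp continuous_subtype_val)

/-- the negative simplex -/
def sNeg {m : ℕ} (j : Fin (m + 3)) : SingSimplex (m + 2) (bipyr m) where
  toFun x := ⟨(fun i => x.1 (j.succAbove i) + 2 / ((m : ℝ) + 2) * x.1 j, - x.1 j), by
    have h := x.2.2
    have hN : (0 : ℝ) < (m : ℝ) + 2 := by positivity
    rw [Fin.sum_univ_succAbove _ j] at h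
    refine ⟨?_, fun i => ?_, fun i => ?_⟩
    · simp only [Finset.sum_add_distrib,
        Finset.sum_const, Finset.card_univ, Fintype.card_fin, nsmul_eq_mul]
      push_cast
      have e : ((m : ℝ) + 2) * (2 / ((m : ℝ) + 2) * x.1 j) = 2 * x.1 j := by field_simp
      rw [e]; linarith
    · have h1 := x.2.1 (j.succAbove i)
      have h2 := x.2.1 j
      simp only
      positivity
    · have h1 := x.2.1 (j.succAbove i)
      simp only
      have e : ((m : ℝ) + 2) * (x.1 (j.succAbove i) + 2 / ((m : ℝ) + 2) * x.1 j) + 2 * -x.1 j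
        = ((m : ℝ) + 2) * x.1 (j.succAbove i) := by field_simp; ring
      rw [e]; positivity⟩
  continuous_toFun := by
    apply Continuous.subtype_mk
    have hc : ∀ i, Continuous (fun x : TSimplex (m + 2) => x.1 i) :=
      fun i => (continuous_apply _).comp continuous_subtype_val
    exact Continuous.prodMk
      (continuous_pi fun i => (hc _).add (continuous_const.mul (hc _))) (hc _).neg

/-- minimum of the coordinates other than the distinguished one -/
def minC {m : ℕ} (j' : Fin (m + 3)) (x : TSimplex (m + 2)) : ℝ :=
  Finset.univ.inf' Finset.univ_nonempty (fun i => x.1 (j'.succAbove i))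

lemma minC_le {m : ℕ} (j' : Fin (m + 3)) (x : TSimplex (m + 2)) (i) :
    minC j' x ≤ x.1 (j'.succAbove i) :=
  Finset.inf'_le (fun i => x.1 (j'.succAbove i)) (Finset.mem_univ i)

lemma minC_nonneg {m : ℕ} (j' : Fin (m + 3)) (x : TSimplex (m + 2)) : 0 ≤ minC j' x :=
  Finset.le_inf' _ _ fun _ _ => x.2.1 _

lemma exists_minC {m : ℕ} (j' : Fin (m + 3)) (x : TSimplex (m + 2)) :
    ∃ i, x.1 (j'.succAbove i) = minC j' x := by
  obtain ⟨i, _, hi⟩ := Finset.exists_mem_eq_inf' Finset.univ_nonempty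
    (fun i : Fin (m + 2) => x.1 (j'.succAbove i))
  exact ⟨i, hi.symm⟩

/-- the glued simplex -/
def sGlue {m : ℕ} (j' : Fin (m + 3)) : SingSimplex (m + 2) (bipyr m) where
  toFun x := ⟨(fun i => x.1 (j'.succAbove i) + minC j' x, x.1 j' - ((m : ℝ) + 2) * minC j' x), by
    have h := x.2.2
    rw [Fin.sum_univ_succAbove _ j'] at h
    have h0 := minC_nonneg j' x
    have h2 := x.2.1 j'
    refine ⟨?_, fun i => add_nonneg (x.2.1 _) h0, fun i => ?_⟩
    · simp only [Finset.sum_add_distrib,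
        Finset.sum_const, Finset.card_univ, Fintype.card_fin, nsmul_eq_mul]
      push_cast; linarith
    · have h1 := minC_le j' x i
      simp only
      have : 0 ≤ ((m : ℝ) + 2) * (x.1 (j'.succAbove i) - minC j' x) :=
        mul_nonneg (by positivity) (by linarith)
      linarith⟩
  continuous_toFun := by
    apply Continuous.subtype_mk
    have hc : ∀ i, Continuous (fun x : TSimplex (m + 2) => x.1 i) :=
      fun i => (continuous_apply _).comp continuous_subtype_val
    have hm : Continuous (minC j') := by
      unfold minC
      exact Continuous.finset_inf'_apply _ fun i _ => hc _
    exact Continuous.prodMk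
      (continuous_pi fun i => (hc _).add hm) ((hc _).sub (continuous_const.mul hm))

lemma bipyrF_sPos {m : ℕ} (σ σ' : SingSimplex (m + 2) M) (j j' : Fin (m + 3))
    (h : σ.comp (faceMap j) = σ'.comp (faceMap j')) :
    (bipyrF σ σ' j j' h).comp (sPos j') = σ' := by
  apply ContinuousMap.ext
  intro x
  have h0 : 0 ≤ (sPos j' x).1.2 := x.2.1 _
  rw [ContinuousMap.comp_apply, bipyrF_pos _ _ _ _ _ _ h0]
  congr 1
  apply TSimplex.ext'
  intro i
  rcases Fin.eq_self_or_eq_succAbove j' i with rfl | ⟨k, rfl⟩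
  · rw [foldIns_self, abs_of_nonneg h0]; rfl
  · rw [foldIns_succAbove, min_eq_right h0, mul_zero, add_zero]; rfl

lemma bipyrF_sNeg {m : ℕ} (σ σ' : SingSimplex (m + 2) M) (j j' : Fin (m + 3))
    (h : σ.comp (faceMap j) = σ'.comp (faceMap j')) :
    (bipyrF σ σ' j j' h).comp (sNeg j) = σ := by
  apply ContinuousMap.ext
  intro x
  have h0 : (sNeg j x).1.2 ≤ 0 := neg_nonpos.2 (x.2.1 _)
  rw [ContinuousMap.comp_apply, bipyrF_neg _ _ _ _ _ _ h0]
  congr 1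
  apply TSimplex.ext'
  intro i
  rcases Fin.eq_self_or_eq_succAbove j i with rfl | ⟨k, rfl⟩
  · rw [foldIns_self, abs_of_nonpos h0]; exact neg_neg _
  · rw [foldIns_succAbove, min_eq_left h0]
    change x.1 (j.succAbove k) + 2 / ((m : ℝ) + 2) * x.1 j + 2 / ((m : ℝ) + 2) * (-x.1 j) = _
    ring

lemma bipyrF_Q {m : ℕ} (σ σ' : SingSimplex (m + 2) M) (j j' : Fin (m + 3))
    (h : σ.comp (faceMap j) = σ'.comp (faceMap j')) {A : Set M}
    (hA : ∀ i, i ≠ j → Set.range (σ.comp (faceMap i)) ⊆ A) (p : bipyr m) (hp : p.1 ∈ bipyrQ m) :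
    bipyrF σ σ' j j' h p ∈ A := by
  obtain ⟨_, k, hk⟩ := hp
  have hN : (0 : ℝ) < (m : ℝ) + 2 := by positivity
  have h0 : p.1.2 ≤ 0 := by
    have := mul_nonneg hN.le (p.2.2.1 k)
    linarith
  rw [bipyrF_neg _ _ _ _ _ _ h0]
  obtain ⟨y, hy⟩ := exists_faceMap (j.succAbove k) (foldIns j p) (by
    rw [foldIns_succAbove, min_eq_left h0]
    field_simp
    linarith)
  rw [← hy]
  exact hA _ (Fin.succAbove_ne _ _) ⟨y, rfl⟩

lemma sGlue_face {m : ℕ} (j' i : Fin (m + 3)) (hi : i ≠ j') :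
    (sGlue j').comp (faceMap i) = (sPos j').comp (faceMap i) := by
  obtain ⟨k, rfl⟩ := Fin.exists_succAbove_eq hi
  apply ContinuousMap.ext
  intro x
  have h0 : minC j' (faceMap (j'.succAbove k) x) = 0 := by
    apply le_antisymm _ (minC_nonneg _ _)
    refine (minC_le j' _ k).trans (faceMap_self _ _).le
  apply Subtype.ext
  refine Prod.ext (funext fun l => ?_) ?_
  · change (faceMap (j'.succAbove k) x).1 (j'.succAbove l) + minC j' (faceMap (j'.succAbove k) x)
      = (faceMap (j'.succAbove k) x).1 (j'.succAbove l)
    rw [h0, add_zero]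
  · change (faceMap (j'.succAbove k) x).1 j'
      - ((m : ℝ) + 2) * minC j' (faceMap (j'.succAbove k) x)
      = (faceMap (j'.succAbove k) x).1 j'
    rw [h0, mul_zero, sub_zero]

lemma sGlue_face_self {m : ℕ} (j' : Fin (m + 3)) (x) :
    ((sGlue j').comp (faceMap j') x).1 ∈ bipyrQ m := by
  refine ⟨Subtype.property _, ?_⟩
  obtain ⟨k, hk⟩ := exists_minC j' (faceMap j' x)
  refine ⟨k, ?_⟩
  change ((m : ℝ) + 2) * ((faceMap j' x).1 (j'.succAbove k) + minC j' (faceMap j' x))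
    + 2 * ((faceMap j' x).1 j' - ((m : ℝ) + 2) * minC j' (faceMap j' x)) = 0
  rw [hk, faceMap_self]; ring

lemma sNeg_face {m : ℕ} (j i : Fin (m + 3)) (hi : i ≠ j) (x) :
    ((sNeg j).comp (faceMap i) x).1 ∈ bipyrQ m := by
  obtain ⟨k, rfl⟩ := Fin.exists_succAbove_eq hi
  refine ⟨Subtype.property _, k, ?_⟩
  change ((m : ℝ) + 2) * ((faceMap (j.succAbove k) x).1 (j.succAbove k)
    + 2 / ((m : ℝ) + 2) * (faceMap (j.succAbove k) x).1 j)
    + 2 * - (faceMap (j.succAbove k) x).1 j = 0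
  rw [faceMap_self]
  have hN : (0 : ℝ) < (m : ℝ) + 2 := by positivity
  field_simp; ring

lemma sNeg_face_self {m : ℕ} (j j' : Fin (m + 3)) :
    (sNeg j).comp (faceMap j) = (sPos j').comp (faceMap j') := by
  apply ContinuousMap.ext
  intro x
  apply Subtype.ext
  refine Prod.ext (funext fun l => ?_) ?_
  · change (faceMap j x).1 (j.succAbove l) + 2 / ((m : ℝ) + 2) * (faceMap j x).1 j
      = (faceMap j' x).1 (j'.succAbove l)
    rw [faceMap_succAbove, faceMap_succAbove, faceMap_self, mul_zero, add_zero]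
  · change - (faceMap j x).1 j = (faceMap j' x).1 j'
    rw [faceMap_self, faceMap_self, neg_zero]

/-- Gluing lemma -/
lemma glue {m : ℕ} {A : Set M} (σ σ' : SingSimplex (m + 2) M) (j j' : Fin (m + 3))
    (h : σ.comp (faceMap j) = σ'.comp (faceMap j'))
    (hA : ∀ i, i ≠ j → Set.range (σ.comp (faceMap i)) ⊆ A) (e e' : ℤ)
    (he : (-1) ^ (j : ℕ) * e + (-1) ^ (j' : ℕ) * e' = 0) :
    ∃ σ'' : SingSimplex (m + 2) M,
      (∀ i, i ≠ j' → σ''.comp (faceMap i) = σ'.comp (faceMap i)) ∧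
      Set.range (σ''.comp (faceMap j')) ⊆ A ∧
      (Finsupp.single σ'' e' - Finsupp.single σ' e' - Finsupp.single σ e : SChain ℤ (m + 2) M)
        ∈ Bdr ℤ (m + 2) A := by
  refine ⟨(bipyrF σ σ' j j' h).comp (sGlue j'), ?_, ?_, ?_⟩
  · intro i hi
    rw [ContinuousMap.comp_assoc, sGlue_face _ _ hi, ← ContinuousMap.comp_assoc, bipyrF_sPos]
  · rintro _ ⟨x, rfl⟩
    exact bipyrF_Q σ σ' j j' h hA _ (sGlue_face_self j' x)
  · have key := model_lemma (bipyr_star m) (bipyrQ_star m) (bipyrF σ σ' j j' h)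
      (bipyrF_Q σ σ' j j' h hA) (m := m)
      (Finsupp.single (sGlue j') e' - Finsupp.single (sPos j') e' - Finsupp.single (sNeg j) e) ?_
    · simpa only [map_sub, push_single, bipyrF_sPos, bipyrF_sNeg] using key
    · rw [map_sub, map_sub, sbdry_single, sbdry_single, sbdry_single,
        Fin.sum_univ_succAbove _ j', Fin.sum_univ_succAbove _ j', Fin.sum_univ_succAbove _ j]
      have e1 : ∑ i : Fin (m + 2), (-1 : ℤ) ^ ((j'.succAbove i : Fin (m + 3)) : ℕ) •
          (Finsupp.single ((sGlue j').comp (faceMap (j'.succAbove i))) e' : SChain ℤ _ _)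
          = ∑ i : Fin (m + 2), (-1 : ℤ) ^ ((j'.succAbove i : Fin (m + 3)) : ℕ) •
          Finsupp.single ((sPos j').comp (faceMap (j'.succAbove i))) e' :=
        Finset.sum_congr rfl fun i _ => by rw [sGlue_face _ _ (Fin.succAbove_ne _ _)]
      rw [e1, sNeg_face_self j j']
      have e2 : (-1 : ℤ) ^ (j : ℕ) •
          (Finsupp.single ((sPos j').comp (faceMap j')) e : SChain ℤ (m + 1) (bipyr m))
          = - ((-1 : ℤ) ^ (j' : ℕ) • Finsupp.single ((sPos j').comp (faceMap j')) e') := by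
        rw [Finsupp.smul_single, Finsupp.smul_single, ← Finsupp.single_neg]
        congr 1
        simp only [smul_eq_mul]
        linarith
      rw [e2]
      have g1 : (-1 : ℤ) ^ (j' : ℕ) •
          (Finsupp.single ((sGlue j').comp (faceMap j')) e' : SChain ℤ (m + 1) (bipyr m))
          ∈ suppOn ℤ (m + 1) {x : bipyr m | x.1 ∈ bipyrQ m} := by
        refine Submodule.smul_mem _ _ (single_mem_suppOn ?_ _)
        rintro _ ⟨x, rfl⟩
        exact sGlue_face_self j' x
      have g2 : ∑ i : Fin (m + 2), (-1 : ℤ) ^ ((j.succAbove i : Fin (m + 3)) : ℕ) •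
          (Finsupp.single ((sNeg j).comp (faceMap (j.succAbove i))) e : SChain ℤ (m + 1) (bipyr m))
          ∈ suppOn ℤ (m + 1) {x : bipyr m | x.1 ∈ bipyrQ m} := by
        refine Submodule.sum_mem _ fun i _ => Submodule.smul_mem _ _ (single_mem_suppOn ?_ _)
        rintro _ ⟨x, rfl⟩
        exact sNeg_face j _ (Fin.succAbove_ne _ _) x
      convert sub_mem g1 g2 using 1
      abel

end

/-! ## The integral norm -/

section nrm
variable {ι κ : Type}

/-- the natural number valued norm of an integral chain -/
def nrm (z : ι →₀ ℤ) : ℕ := z.sum fun _ a => a.natAbs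

lemma nrm_eq_sum (z : ι →₀ ℤ) (S : Finset ι) (h : z.support ⊆ S) :
    nrm z = ∑ i ∈ S, (z i).natAbs :=
  Finsupp.sum_of_support_subset z h _ (by simp)

lemma nrm_zero : nrm (0 : ι →₀ ℤ) = 0 := by simp [nrm]

lemma nrm_eq_zero {z : ι →₀ ℤ} (h : nrm z = 0) : z = 0 := by
  classical
  ext i
  by_contra hi
  rw [nrm_eq_sum z _ subset_rfl, Finset.sum_eq_zero_iff] at h
  have := h i (Finsupp.mem_support_iff.2 hi)
  exact hi (by simpa using this)

lemma nrm_add_le (z w : ι →₀ ℤ) : nrm (z + w) ≤ nrm z + nrm w := by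
  classical
  rw [nrm_eq_sum (z + w) (z.support ∪ w.support) Finsupp.support_add,
    nrm_eq_sum z (z.support ∪ w.support) Finset.subset_union_left,
    nrm_eq_sum w (z.support ∪ w.support) Finset.subset_union_right, ← Finset.sum_add_distrib]
  exact Finset.sum_le_sum fun i _ => Int.natAbs_add_le _ _

lemma nrm_single (i : ι) (a : ℤ) : nrm (Finsupp.single i a) = a.natAbs := by
  simp [nrm]

lemma nrm_sum_le {α : Type} (s : Finset α) (f : α → ι →₀ ℤ) :
    nrm (∑ a ∈ s, f a) ≤ ∑ a ∈ s, nrm (f a) := by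
  classical
  induction s using Finset.induction_on with
  | empty => simp [nrm_zero]
  | insert a s ha ih =>
    rw [Finset.sum_insert ha, Finset.sum_insert ha]
    exact (nrm_add_le _ _).trans (by omega)

lemma nrm_smul (e : ℤ) (z : ι →₀ ℤ) : nrm (e • z) = e.natAbs * nrm z := by
  rw [nrm_eq_sum (e • z) z.support Finsupp.support_smul, nrm_eq_sum z _ subset_rfl,
    Finset.mul_sum]
  simp [Int.natAbs_mul]

lemma nrm_mapDomain_le (f : ι → κ) (z : ι →₀ ℤ) : nrm (Finsupp.mapDomain f z) ≤ nrm z := by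
  unfold Finsupp.mapDomain
  refine (nrm_sum_le _ _).trans ?_
  simp only [nrm_single]
  exact le_rfl

lemma nrm_sub_sign (z : ι →₀ ℤ) (i : ι) (h : z i ≠ 0) :
    nrm (z - Finsupp.single i (z i).sign) + 1 = nrm z := by
  classical
  have hs : (z - Finsupp.single i (z i).sign).support ⊆ z.support := by
    intro j hj
    rw [Finsupp.mem_support_iff] at hj ⊢
    by_cases hij : i = j
    · subst hij; exact h
    · simpa [Finsupp.single_apply, hij] using hj
  have hi : i ∈ z.support := Finsupp.mem_support_iff.2 h
  rw [nrm_eq_sum _ _ hs, nrm_eq_sum z _ subset_rfl, ← Finset.add_sum_erase _ _ hi,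
    ← Finset.add_sum_erase z.support _ hi]
  have e1 : ∑ j ∈ z.support.erase i, ((z - Finsupp.single i (z i).sign) j).natAbs
      = ∑ j ∈ z.support.erase i, (z j).natAbs := by
    refine Finset.sum_congr rfl fun j hj => ?_
    have : i ≠ j := (Finset.ne_of_mem_erase hj).symm
    simp [Finsupp.single_apply, this]
  rw [e1]
  have e2 : ((z - Finsupp.single i (z i).sign) i).natAbs + 1 = (z i).natAbs := by
    simp only [Finsupp.sub_apply, Finsupp.single_eq_same]
    rcases lt_or_gt_of_ne h with h' | h'
    · rw [Int.sign_eq_neg_one_of_neg h']; omega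
    · rw [Int.sign_eq_one_of_pos h']; omega
  omega

/-- representing an integral chain by a family -/
lemma exists_family (N : ℕ) (z : ι →₀ ℤ) (h : nrm z = N) :
    ∃ (eps : Fin N → ℤ) (σ : Fin N → ι), z = ∑ i, eps i • Finsupp.single (σ i) (1 : ℤ) ∧
      (∀ i, eps i = 1 ∨ eps i = -1) ∧ ∀ i, σ i ∈ z.support := by
  induction N generalizing z with
  | zero =>
    refine ⟨Fin.elim0, Fin.elim0, ?_, fun i => i.elim0, fun i => i.elim0⟩
    rw [nrm_eq_zero h]; simp
  | succ N ih =>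
    have hz : z ≠ 0 := by rintro rfl; rw [nrm_zero] at h; omega
    obtain ⟨i, hi⟩ : ∃ i, z i ≠ 0 := by
      by_contra! hh
      exact hz (Finsupp.ext hh)
    have h1 := nrm_sub_sign z i hi
    obtain ⟨eps, σ, e1, e2, e3⟩ := ih (z - Finsupp.single i (z i).sign) (by omega)
    refine ⟨Fin.cons (z i).sign eps, Fin.cons i σ, ?_, ?_, ?_⟩
    · rw [Fin.sum_univ_succ]
      simp only [Fin.cons_zero, Fin.cons_succ]
      rw [← e1]; simp
    · intro j
      refine Fin.cases ?_ (fun j => ?_) j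
      · rw [Fin.cons_zero]
        rcases lt_or_gt_of_ne hi with h' | h'
        · right; exact Int.sign_eq_neg_one_of_neg h'
        · left; exact Int.sign_eq_one_of_pos h'
      · simpa using e2 j
    · intro j
      refine Fin.cases ?_ (fun j => ?_) j
      · simpa using hi
      · rw [Fin.cons_succ]
        have := e3 j
        rw [Finsupp.mem_support_iff] at this ⊢
        intro h0
        apply this
        have : i ≠ σ j := by rintro rfl; exact hi h0
        simp [Finsupp.single_apply, this, h0]

end nrm

/-! ## Doubling and subdividing a simplex with all faces in the boundary -/

/-- first folding vertex map -/
def fold1 (m : ℕ) (i : Fin (m + 3)) : Fin (m + 2) :=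
  ⟨if (i : ℕ) = 2 then 0 else if (i : ℕ) < 2 then i else i - 1, by split_ifs <;> omega⟩

/-- second folding vertex map -/
def fold2 (m : ℕ) (i : Fin (m + 3)) : Fin (m + 2) := ⟨i - 1, by omega⟩

lemma succAbove_val {n : ℕ} (j : Fin (n+1)) (i : Fin n) : ((j.succAbove i : Fin (n+1)) : ℕ) = if (i:ℕ) < j then (i:ℕ) else i + 1 := by
  simp only [Fin.succAbove, Fin.lt_def, Fin.val_castSucc]
  split_ifs <;> rfl

lemma fold1_two (m : ℕ) : fold1 m ∘ (⟨2, by omega⟩ : Fin (m + 3)).succAbove = id := by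
  ext i
  simp only [fold1, Function.comp, succAbove_val, id]
  split_ifs <;> omega

lemma fold2_zero (m : ℕ) : fold2 m ∘ (⟨0, by omega⟩ : Fin (m + 3)).succAbove = id := by
  ext i
  simp only [fold2, Function.comp, Fin.succAbove, Fin.lt_def, id]
  split_ifs <;> simp at * <;> omega

lemma fold12 (m : ℕ) : fold1 m ∘ (⟨1, by omega⟩ : Fin (m + 3)).succAbove
    = fold2 m ∘ (⟨2, by omega⟩ : Fin (m + 3)).succAbove := by
  ext i
  simp only [fold1, fold2, Function.comp, succAbove_val]
  split_ifs <;> omega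

section
variable {M : Type} [TopologicalSpace M]

lemma range_comp_sub {a b : ℕ} {A : Set M} {σ : SingSimplex a M} (h : Set.range σ ⊆ A)
    (f : C(TSimplex b, TSimplex a)) : Set.range (σ.comp f) ⊆ A := by
  rintro _ ⟨x, rfl⟩
  exact h ⟨_, rfl⟩

lemma double {m : ℕ} {A : Set M} (σ : SingSimplex (m + 2) M)
    (hA : ∀ i, Set.range (σ.comp (faceMap i)) ⊆ A) :
    ∃ σ' : SingSimplex (m + 2) M, (∀ i, Set.range (σ'.comp (faceMap i)) ⊆ A) ∧
      (Finsupp.single σ' (-1) - (2 : ℤ) • Finsupp.single σ 1 : SChain ℤ (m + 2) M)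
        ∈ Bdr ℤ (m + 2) A := by
  have f2 : (⟨0, by omega⟩ : Fin (m + 3)) = 0 := rfl
  set τ : SingSimplex (m + 1) M := σ.comp (faceMap 0) with hτ
  set ρ1 : SingSimplex (m + 2) M := τ.comp (affMap (fold1 m)) with hρ1
  set ρ2 : SingSimplex (m + 2) M := τ.comp (affMap (fold2 m)) with hρ2
  have hρ1A : Set.range ρ1 ⊆ A := range_comp_sub (hA 0) _
  have hρ2A : Set.range ρ2 ⊆ A := range_comp_sub (hA 0) _
  have g1 : σ.comp (faceMap 0) = ρ1.comp (faceMap ⟨2, by omega⟩) := by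
    rw [hρ1, ContinuousMap.comp_assoc, faceMap_eq_affMap ⟨2, _⟩, affMap_comp, fold1_two, affMap_id,
      ContinuousMap.comp_id]
  have g2 : σ.comp (faceMap 0) = ρ2.comp (faceMap ⟨0, by omega⟩) := by
    rw [hρ2, ContinuousMap.comp_assoc, faceMap_eq_affMap ⟨0, _⟩, affMap_comp, fold2_zero, affMap_id,
      ContinuousMap.comp_id]
  have g3 : ρ1.comp (faceMap ⟨1, by omega⟩) = ρ2.comp (faceMap ⟨2, by omega⟩) := by
    have e1 := ContinuousMap.comp_assoc τ (affMap (fold1 m)) (affMap (⟨1, by omega⟩ : Fin (m + 3)).succAbove)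
    have e2 := ContinuousMap.comp_assoc τ (affMap (fold2 m)) (affMap (⟨2, by omega⟩ : Fin (m + 3)).succAbove)
    rw [affMap_comp] at e1 e2
    rw [fold12] at e1
    exact e1.trans e2.symm
  obtain ⟨σ1, a1, b1, c1⟩ := glue σ ρ1 0 ⟨2, by omega⟩ g1 (fun i _ => hA i) 1 (-1) (by simp)
  obtain ⟨σ2, a2, b2, c2⟩ := glue σ ρ2 0 ⟨0, by omega⟩ g2 (fun i _ => hA i) 1 (-1) (by simp)
  have h1 : ∀ i, Set.range (σ1.comp (faceMap i)) ⊆ A := by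
    intro i
    by_cases hi : i = ⟨2, by omega⟩
    · rw [hi]; exact b1
    · rw [a1 i hi]; exact range_comp_sub hρ1A _
  have h2 : ∀ i, Set.range (σ2.comp (faceMap i)) ⊆ A := by
    intro i
    by_cases hi : i = ⟨0, by omega⟩
    · rw [hi]; exact b2
    · rw [a2 i hi]; exact range_comp_sub hρ2A _
  have g4 : σ1.comp (faceMap ⟨1, by omega⟩) = σ2.comp (faceMap ⟨2, by omega⟩) := by
    rw [a1 _ (by simp [Fin.ext_iff]), a2 _ (by simp [Fin.ext_iff]), g3]
  obtain ⟨σ3, a3, b3, c3⟩ := glue σ1 σ2 ⟨1, by omega⟩ ⟨2, by omega⟩ g4 (fun i _ => h1 i) (-1) (-1)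
    (by simp)
  refine ⟨σ3, ?_, ?_⟩
  · intro i
    by_cases hi : i = ⟨2, by omega⟩
    · rw [hi]; exact b3
    · rw [a3 i hi]; exact h2 i
  · have d1 : (Finsupp.single ρ1 (-1) : SChain ℤ (m + 2) M) ∈ Bdr ℤ (m + 2) A :=
      suppOn_le_Bdr (single_mem_suppOn hρ1A _)
    have d2 : (Finsupp.single ρ2 (-1) : SChain ℤ (m + 2) M) ∈ Bdr ℤ (m + 2) A :=
      suppOn_le_Bdr (single_mem_suppOn hρ2A _)
    convert add_mem (add_mem (add_mem c3 c1) c2) (add_mem d1 d2) using 1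
    rw [two_smul]
    abel

lemma double_iter {m : ℕ} {A : Set M} (σ : SingSimplex (m + 2) M)
    (hA : ∀ i, Set.range (σ.comp (faceMap i)) ⊆ A) (t : ℕ) :
    ∃ (σ' : SingSimplex (m + 2) M) (s : ℤ), (s = 1 ∨ s = -1) ∧
      (∀ i, Set.range (σ'.comp (faceMap i)) ⊆ A) ∧
      (s • Finsupp.single σ' 1 - (2 : ℤ) ^ t • Finsupp.single σ 1 : SChain ℤ (m + 2) M)
        ∈ Bdr ℤ (m + 2) A := by
  induction t with
  | zero => exact ⟨σ, 1, Or.inl rfl, hA, by simp⟩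
  | succ t ih =>
    obtain ⟨σ', s, hs, h1, h2⟩ := ih
    obtain ⟨σ'', h3, h4⟩ := double σ' h1
    refine ⟨σ'', -s, by rcases hs with rfl | rfl <;> simp, h3, ?_⟩
    have h5 := add_mem (Submodule.smul_mem _ s h4) (Submodule.smul_mem _ 2 h2)
    convert h5 using 1
    have : (Finsupp.single σ'' (-1) : SChain ℤ (m + 2) M) = - Finsupp.single σ'' 1 := by
      rw [← Finsupp.single_neg]
    rw [this, pow_succ]
    module

lemma cone_subdiv {m : ℕ} {A : Set M} (σ : SingSimplex (m + 2) M) (b : TSimplex (m + 2))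
    (hb : σ b ∉ A) :
    ∃ w : SChain ℤ (m + 2) M, w - Finsupp.single σ 1 ∈ Bdr ℤ (m + 2) A ∧ nrm w ≤ m + 3 ∧
      ∀ σ' ∈ w.support, ∀ i : Fin (m + 2), ¬ Set.range (σ'.comp (faceMap i.succ)) ⊆ A := by
  classical
  let D : Set (Fin (m + 3) → ℝ) := {x | (∀ i, 0 ≤ x i) ∧ ∑ i, x i = 1}
  have hD : StarConvex ℝ b.1 D := by
    have : Convex ℝ D := convex_stdSimplex ℝ (Fin (m + 3))
    exact this.starConvex b.2
  let F : C(D, M) := ⟨fun x => σ x, σ.continuous⟩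
  let idD : SingSimplex (m + 2) D := ⟨fun x => x, continuous_id⟩
  have hF : F.comp idD = σ := rfl
  have hw : push ℤ F (m + 2) (coneC hD (m + 1) (sbdry ℤ (Finsupp.single idD 1)))
      = ∑ i : Fin (m + 3), ((-1 : ℤ) ^ (i : ℕ)) •
        Finsupp.single (F.comp (coneS hD (idD.comp (faceMap i)))) 1 := by
    rw [sbdry_single, map_sum, map_sum]
    refine Finset.sum_congr rfl fun i _ => ?_
    rw [map_smul, map_smul, coneC_single, push_single]
  refine ⟨push ℤ F (m + 2) (coneC hD (m + 1) (sbdry ℤ (Finsupp.single idD 1))), ?_, ?_, ?_⟩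
  · have h1 := sbdry_coneC hD (Finsupp.single idD 1)
    have h2 : coneC hD (m + 1) (sbdry ℤ (Finsupp.single idD 1)) - Finsupp.single idD 1
      = - sbdry ℤ (coneC hD (m + 2) (Finsupp.single idD 1)) := by
      rw [h1]; abel
    have h3 := congrArg (push ℤ F (m + 2)) h2
    rw [map_sub, map_neg, ← sbdry_push, push_single, hF] at h3
    rw [h3]
    exact neg_mem (sbdry_mem_Bdr _)
  · rw [hw]
    refine (nrm_sum_le _ _).trans ?_
    simp [nrm_smul, nrm_single, Int.natAbs_pow]
  · intro σ' hσ' i hi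
    rw [hw] at hσ'
    have h1 := Finsupp.support_finsetSum hσ'
    rw [Finset.mem_biUnion] at h1
    obtain ⟨l, -, hl⟩ := h1
    have h2 := Finsupp.support_single_subset (Finsupp.support_smul hl)
    rw [Finset.mem_singleton] at h2
    subst h2
    obtain ⟨x, hx⟩ := coneS_apex hD ((idD.comp (faceMap l)).comp (faceMap i))
    apply hb
    rw [ContinuousMap.comp_assoc, coneS_face_succ] at hi
    have h3 : F (coneS hD ((idD.comp (faceMap l)).comp (faceMap i)) x) ∈ A := hi ⟨x, rfl⟩
    have h4 : coneS hD ((idD.comp (faceMap l)).comp (faceMap i)) x = b := Subtype.ext hx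
    rw [h4] at h3
    exact h3

end

/-! ## Efficient cycles -/

section eff
variable {M : Type} [TopologicalSpace M] {m : ℕ}

/-- efficient multiples of the fundamental class -/
def Eff (A : Set M) (c : SChain ℤ (m + 2) M) (r : ℝ) (z : SChain ℤ (m + 2) M) : Prop :=
  z ∉ Bdr ℤ (m + 2) A ∧ ∃ d : ℤ, 0 < d ∧ z - d • c ∈ Bdr ℤ (m + 2) A ∧ (nrm z : ℝ) ≤ d * r

/-- relative cycle -/
def RC (A : Set M) (z : SChain ℤ (m + 2) M) : Prop := sbdry ℤ z ∈ suppOn ℤ (m + 1) A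

/-- every simplex has two faces outside of `A` -/
def TwoFree (A : Set M) (z : SChain ℤ (m + 2) M) : Prop :=
  ∀ σ ∈ z.support, ∃ j j' : Fin (m + 3), j ≠ j' ∧ ¬ Set.range (σ.comp (faceMap j)) ⊆ A ∧
    ¬ Set.range (σ.comp (faceMap j')) ⊆ A

variable {A : Set M} {c : SChain ℤ (m + 2) M} {r : ℝ} {z : SChain ℤ (m + 2) M}

lemma mem_of_sub_mem {V : Type} [AddCommGroup V] [Module ℤ V] {S : Submodule ℤ V} {a b : V}
    (h : a - b ∈ S) (hb : b ∈ S) : a ∈ S := by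
  have := add_mem h hb
  simpa using this

lemma RC_of_sub {z' : SChain ℤ (m + 2) M} (h : z' - z ∈ Bdr ℤ (m + 2) A) (hz : RC A z) :
    RC A z' := by
  have := sbdry_of_mem_Bdr h
  rw [map_sub] at this
  exact mem_of_sub_mem this hz

lemma Eff.rc (hc : RC A c) (h : Eff A c r z) : RC A z := by
  obtain ⟨-, d, -, h, -⟩ := h
  refine RC_of_sub h ?_
  unfold RC
  rw [map_smul]
  exact Submodule.smul_mem _ _ hc

lemma Eff.inv {z' : SChain ℤ (m + 2) M} (h : Eff A c r z) (h' : z' - z ∈ Bdr ℤ (m + 2) A)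
    (hn : nrm z' ≤ nrm z) : Eff A c r z' := by
  obtain ⟨h1, d, hd, h2, h3⟩ := h
  refine ⟨fun h4 => h1 ?_, d, hd, ?_, le_trans (by exact_mod_cast hn) h3⟩
  · have := sub_mem h4 h'
    simpa using this
  · have := add_mem h' h2
    simpa using this

lemma Eff.of_torsion (hr : 0 < r)
    (hgen : ∀ z : SChain ℤ (m + 2) M, RC A z → ∃ k : ℤ, z - k • c ∈ Bdr ℤ (m + 2) A)
    {k0 : ℤ} (hk0 : 0 < k0) (ht : k0 • c ∈ Bdr ℤ (m + 2) A) (hz : RC A z)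
    (hz' : z ∉ Bdr ℤ (m + 2) A) : Eff A c r z := by
  obtain ⟨k, hk⟩ := hgen z hz
  obtain ⟨T, hT⟩ := exists_nat_gt ((nrm z : ℝ) / r)
  have h1 : (nrm z : ℝ) ≤ T * r := by
    rw [div_lt_iff₀ hr] at hT; exact hT.le
  have h0 : k + |k| ≥ 0 := by
    have := neg_abs_le k; linarith
  have h2 : (T : ℤ) + 1 ≤ k + k0 * (T + 1 + |k|) := by
    nlinarith [abs_nonneg k, mul_nonneg (by linarith : (0:ℤ) ≤ k0 - 1)
      (by positivity : (0 : ℤ) ≤ T + 1 + |k|)]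
  refine ⟨hz', k + k0 * (T + 1 + |k|), by omega, ?_, ?_⟩
  · have := sub_mem hk (Submodule.smul_mem _ (T + 1 + |k|) ht)
    convert this using 1
    module
  · refine h1.trans ?_
    have : ((T : ℤ) : ℝ) ≤ ((k + k0 * (T + 1 + |k|) : ℤ) : ℝ) := by
      exact_mod_cast (by omega : (T : ℤ) ≤ k + k0 * (T + 1 + |k|))
    rw [Int.cast_natCast] at this
    exact mul_le_mul_of_nonneg_right this hr.le

lemma torsion_or (A : Set M) (c : SChain ℤ (m + 2) M) :
    (∃ k0 : ℤ, 0 < k0 ∧ k0 • c ∈ Bdr ℤ (m + 2) A) ∨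
    (∀ k : ℤ, k • c ∈ Bdr ℤ (m + 2) A → k = 0) := by
  by_cases h : ∃ k0 : ℤ, 0 < k0 ∧ k0 • c ∈ Bdr ℤ (m + 2) A
  · exact Or.inl h
  · right
    intro k hk
    push Not at h
    rcases lt_trichotomy k 0 with h' | h' | h'
    · exact absurd (by rw [neg_smul]; exact neg_mem hk) (h (-k) (by omega))
    · exact h'
    · exact absurd hk (h k h')

lemma eff_split_aux (hr : 0 < r)
    (hnt : ∀ k : ℤ, k • c ∈ Bdr ℤ (m + 2) A → k = 0) {z1 z2 : SChain ℤ (m + 2) M}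
    (h : Eff A c r (z1 + z2))
    {d : ℤ} (hd : z1 - d • c ∈ Bdr ℤ (m + 2) A) (hle : (nrm z1 : ℝ) ≤ d * r) :
    Eff A c r z1 ∨ Eff A c r z2 := by
  have hd0 : (0 : ℝ) ≤ d := by
    by_contra hneg
    push Not at hneg
    have := mul_neg_of_neg_of_pos hneg hr
    have h0 : (0 : ℝ) ≤ nrm z1 := Nat.cast_nonneg _
    linarith
  have hd0' : 0 ≤ d := by exact_mod_cast hd0
  rcases hd0'.eq_or_lt with h0 | h0
  · right
    subst h0
    have : nrm z1 = 0 := by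
      have : (nrm z1 : ℝ) ≤ 0 := by simpa using hle
      exact_mod_cast le_antisymm this (Nat.cast_nonneg _)
    rw [nrm_eq_zero this, zero_add] at h
    exact h
  · left
    refine ⟨fun hb => ?_, d, h0, hd, hle⟩
    have := sub_mem hb hd
    rw [sub_sub_cancel] at this
    have := hnt d this
    omega

lemma eff_split (hr : 0 < r)
    (hgen : ∀ z : SChain ℤ (m + 2) M, RC A z → ∃ k : ℤ, z - k • c ∈ Bdr ℤ (m + 2) A)
    {z1 z2 : SChain ℤ (m + 2) M} (h : Eff A c r (z1 + z2)) (h1 : RC A z1) (h2 : RC A z2)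
    (hn : nrm z1 + nrm z2 ≤ nrm (z1 + z2)) : Eff A c r z1 ∨ Eff A c r z2 := by
  rcases torsion_or A c with ⟨k0, hk0, ht⟩ | hnt
  · by_cases hb1 : z1 ∈ Bdr ℤ (m + 2) A
    · right
      refine Eff.of_torsion hr hgen hk0 ht h2 fun hb2 => h.1 (add_mem hb1 hb2)
    · left
      exact Eff.of_torsion hr hgen hk0 ht h1 hb1
  · obtain ⟨d, hd, hzd, hnd⟩ := h.2
    obtain ⟨d1, hd1⟩ := hgen z1 h1
    obtain ⟨d2, hd2⟩ := hgen z2 h2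
    have e : d1 + d2 - d = 0 := by
      apply hnt
      have := sub_mem (sub_mem hzd hd1) hd2
      convert this using 1
      module
    have e' : (d : ℝ) = d1 + d2 := by
      have : d = d1 + d2 := by omega
      rw [this]; push_cast; rfl
    have hn' : (nrm z1 : ℝ) + nrm z2 ≤ nrm (z1 + z2) := by exact_mod_cast hn
    rw [e', add_mul] at hnd
    by_cases hc1 : (nrm z1 : ℝ) ≤ d1 * r
    · exact eff_split_aux hr hnt h hd1 hc1
    · have hc2 : (nrm z2 : ℝ) ≤ d2 * r := by linarith
      rw [add_comm] at h
      exact (eff_split_aux hr hnt h hd2 hc2).symm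

lemma eff_pow (hr : 0 < r) (hc : RC A c)
    (hgen : ∀ z : SChain ℤ (m + 2) M, RC A z → ∃ k : ℤ, z - k • c ∈ Bdr ℤ (m + 2) A)
    (h : Eff A c r z) (B : ℕ) : ∃ t : ℕ, ∀ w : SChain ℤ (m + 2) M,
      w - (2 : ℤ) ^ t • z ∈ Bdr ℤ (m + 2) A → nrm w ≤ B → Eff A c r w := by
  rcases torsion_or A c with ⟨k0, hk0, ht⟩ | hnt
  · refine ⟨0, fun w hw _ => ?_⟩
    rw [pow_zero, one_smul] at hw
    refine Eff.of_torsion hr hgen hk0 ht (RC_of_sub hw (h.rc hc)) fun hb => h.1 ?_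
    have := sub_mem hb hw
    simpa using this
  · obtain ⟨d, hd, hzd, -⟩ := h.2
    obtain ⟨t, ht⟩ := pow_unbounded_of_one_lt ((B : ℝ) / r) (by norm_num : (1 : ℝ) < 2)
    rw [div_lt_iff₀ hr] at ht
    refine ⟨t, fun w hw hn => ?_⟩
    have h1 : w - ((2 : ℤ) ^ t * d) • c ∈ Bdr ℤ (m + 2) A := by
      have := add_mem hw (Submodule.smul_mem _ ((2 : ℤ) ^ t) hzd)
      convert this using 1
      module
    have h2 : 0 < (2 : ℤ) ^ t * d := by positivity
    refine ⟨fun hb => ?_, (2 : ℤ) ^ t * d, h2, h1, ?_⟩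
    · have := sub_mem hb h1
      rw [sub_sub_cancel] at this
      have := hnt _ this
      omega
    · have hd1 : (1 : ℝ) ≤ d := by exact_mod_cast hd
      push_cast
      have h3 : (nrm w : ℝ) ≤ B := by exact_mod_cast hn
      have h4 : (0 : ℝ) ≤ 2 ^ t * r := by positivity
      nlinarith

lemma sbdry_apply (z : SChain ℤ (m + 2) M) (τ : SingSimplex (m + 1) M) :
    sbdry ℤ z τ = ∑ p ∈ z.support ×ˢ (Finset.univ : Finset (Fin (m + 3))),
      letI := Classical.propDecidable (p.1.comp (faceMap p.2) = τ)
      if p.1.comp (faceMap p.2) = τ then ((-1) ^ (p.2 : ℕ)) * z p.1 else 0 := by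
  classical
  conv_lhs => rw [← Finsupp.sum_single z, Finsupp.sum, map_sum]
  rw [Finset.sum_product, Finsupp.finset_sum_apply]
  refine Finset.sum_congr rfl fun σ _ => ?_
  rw [sbdry_single, Finsupp.finset_sum_apply]
  refine Finset.sum_congr rfl fun i _ => ?_
  simp only [Finsupp.smul_apply, Finsupp.single_apply]
  split_ifs <;> simp

lemma exists_partner (hz : RC A z) {σ : SingSimplex (m + 2) M} (hσ : σ ∈ z.support)
    (j : Fin (m + 3)) (hj : ¬ Set.range (σ.comp (faceMap j)) ⊆ A) :
    ∃ σ' ∈ z.support, ∃ j', σ'.comp (faceMap j') = σ.comp (faceMap j) ∧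
      ((-1) ^ (j : ℕ) * z σ) * ((-1) ^ (j' : ℕ) * z σ') < 0 := by
  classical
  by_contra! hcon
  set τ := σ.comp (faceMap j) with hτ
  have h0 : sbdry ℤ z τ = 0 := by
    by_contra h
    exact hj ((Finsupp.mem_supported _ _).1 hz (Finsupp.mem_support_iff.2 h))
  set u : ℤ := (-1) ^ (j : ℕ) * z σ with hu
  have hu0 : u ≠ 0 := mul_ne_zero (by simp) (Finsupp.mem_support_iff.1 hσ)
  have h1 : u * sbdry ℤ z τ > 0 := by
    rw [sbdry_apply, Finset.mul_sum]
    refine Finset.sum_pos' (fun p hp => ?_) ⟨(σ, j), by simpa using hσ, ?_⟩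
    · split_ifs with hh
      · exact hcon p.1 (Finset.mem_product.1 hp).1 p.2 hh
      · simp
    · dsimp only
      rw [if_pos hτ.symm]
      exact mul_self_pos.2 hu0
  rw [h0] at h1
  simp at h1

lemma sign_cancel {a b u v : ℤ} (ha : a = 1 ∨ a = -1) (hb : b = 1 ∨ b = -1)
    (h : (a * u) * (b * v) < 0) : a * u.sign + b * v.sign = 0 := by
  have hs := Int.sign_eq_neg_one_of_neg h
  rw [Int.sign_mul, Int.sign_mul, Int.sign_mul] at hs
  rcases ha with rfl | rfl <;> rcases hb with rfl | rfl <;>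
    rcases Int.sign_trichotomy u with h1 | h1 | h1 <;>
    rcases Int.sign_trichotomy v with h2 | h2 | h2 <;>
    rw [h1, h2] at hs ⊢ <;> revert hs <;> decide

lemma exists_eff_twoFree (hr : 0 < r) (hc : RC A c)
    (hgen : ∀ z : SChain ℤ (m + 2) M, RC A z → ∃ k : ℤ, z - k • c ∈ Bdr ℤ (m + 2) A)
    (N : ℕ) : ∀ z : SChain ℤ (m + 2) M, nrm z = N → Eff A c r z →
      ∃ w, Eff A c r w ∧ TwoFree A w := by
  classical
  induction N using Nat.strong_induction_on with
  | _ N ih =>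
  intro z hN hz
  by_cases hQ : TwoFree A z
  · exact ⟨z, hz, hQ⟩
  unfold TwoFree at hQ
  push Not at hQ
  obtain ⟨σ, hσ, hf⟩ := hQ
  have hσ0 : z σ ≠ 0 := Finsupp.mem_support_iff.1 hσ
  have hzr := hz.rc hc
  have hnn := nrm_sub_sign z σ hσ0
  set e := (z σ).sign with he
  have he1 : e = 1 ∨ e = -1 := by
    rcases lt_or_gt_of_ne hσ0 with h' | h'
    · right; exact Int.sign_eq_neg_one_of_neg h'
    · left; exact Int.sign_eq_one_of_pos h'
  by_cases hall : ∀ j, Set.range (σ.comp (faceMap j)) ⊆ A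
  · have r1 : RC A (Finsupp.single σ e : SChain ℤ (m + 2) M) := by
      unfold RC
      rw [sbdry_single]
      exact sum_mem fun i _ => Submodule.smul_mem _ _ (single_mem_suppOn (hall i) _)
    have r2 : RC A (z - Finsupp.single σ e) := by
      unfold RC
      rw [map_sub]
      exact sub_mem hzr r1
    have hsum : Finsupp.single σ e + (z - Finsupp.single σ e) = z := by abel
    have hne : nrm (Finsupp.single σ e) = 1 := by
      rw [nrm_single]; rcases he1 with h | h <;> rw [h] <;> rfl
    rcases eff_split hr hgen (z1 := Finsupp.single σ e) (z2 := z - Finsupp.single σ e)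
      (by rw [hsum]; exact hz) r1 r2 (by rw [hsum, hne]; omega) with h | h
    · obtain ⟨t, ht⟩ := eff_pow hr hc hgen h (m + 3)
      obtain ⟨σ', s, hs, hA', hB⟩ := double_iter σ hall t
      have hes : (Finsupp.single σ e : SChain ℤ (m + 2) M) = e • Finsupp.single σ 1 := by simp
      have hB' : (e * s) • Finsupp.single σ' 1 - (2 : ℤ) ^ t • Finsupp.single σ e
          ∈ Bdr ℤ (m + 2) A := by
        have := Submodule.smul_mem _ e hB
        rw [hes]
        convert this using 1
        module
      have hK' : Eff A c r ((e * s) • Finsupp.single σ' 1) := by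
        refine ht _ hB' ?_
        rw [nrm_smul, nrm_single]
        rcases he1 with h | h <;> rcases hs with h' | h' <;> rw [h, h'] <;> simp
      have hnot : ¬ Set.range σ' ⊆ A := by
        intro hsub
        exact hK'.1 (Submodule.smul_mem _ _ (suppOn_le_Bdr (single_mem_suppOn hsub _)))
      obtain ⟨_, ⟨b, rfl⟩, hb⟩ := Set.not_subset.1 hnot
      obtain ⟨w, w1, w2, w3⟩ := cone_subdiv σ' b hb
      refine ⟨(e * s) • w, ?_, ?_⟩
      · refine ht _ ?_ ?_
        · have := add_mem (Submodule.smul_mem _ (e * s) w1) hB'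
          convert this using 1
          module
        · rw [nrm_smul]
          rcases he1 with h | h <;> rcases hs with h' | h' <;> rw [h, h'] <;> simpa using w2
      · intro ρ hρ
        have h5 := w3 ρ (Finsupp.support_smul hρ)
        refine ⟨Fin.succ ⟨0, by omega⟩, Fin.succ ⟨1, by omega⟩, ?_, h5 _, h5 _⟩
        intro hh
        have := congrArg (fun i : Fin (m + 3) => (i : ℕ)) hh
        simp only [Fin.val_succ] at this
        omega
    · exact ih _ (by omega) _ rfl h
  · push Not at hall
    obtain ⟨j, hj⟩ := hall
    have hother : ∀ i ≠ j, Set.range (σ.comp (faceMap i)) ⊆ A := by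
      intro i hi
      exact hf j i hi.symm hj
    obtain ⟨σ', hσ', j', hface, hsgn⟩ := exists_partner hzr hσ j hj
    have hne : σ ≠ σ' := by
      rintro rfl
      have : j' = j := by
        by_contra hjj
        exact hj (hface ▸ hother j' hjj)
      subst this
      exact absurd hsgn (not_lt.2 (mul_self_nonneg _))
    have hσ'0 : z σ' ≠ 0 := Finsupp.mem_support_iff.1 hσ'
    have hcan := sign_cancel (neg_one_pow_eq_or ℤ (j : ℕ)) (neg_one_pow_eq_or ℤ (j' : ℕ)) hsgn
    obtain ⟨σ'', -, -, hB⟩ := glue σ σ' j j' hface.symm hother e (z σ').sign hcan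
    have hzz : (z - Finsupp.single σ e) σ' = z σ' := by
      simp [Finsupp.single_apply, hne]
    have hn2 := nrm_sub_sign (z - Finsupp.single σ e) σ' (by rw [hzz]; exact hσ'0)
    rw [hzz] at hn2
    have hn3 := nrm_add_le (z - Finsupp.single σ e - Finsupp.single σ' (z σ').sign)
      (Finsupp.single σ'' (z σ').sign)
    have hn4 : nrm (Finsupp.single σ'' (z σ').sign) = 1 := by
      rw [nrm_single, Int.natAbs_sign_of_ne_zero hσ'0]
    refine ih _ ?_ (z - Finsupp.single σ e - Finsupp.single σ' (z σ').sign
      + Finsupp.single σ'' (z σ').sign) rfl ?_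
    · omega
    · refine hz.inv ?_ (by omega)
      convert hB using 1
      abel

end eff

/-! ## Rounding real cycles -/

section rounding
variable {X : Type} [TopologicalSpace X] {n : ℕ}

lemma intToReal_apply (c : SChain ℤ n X) (σ) : intToReal c σ = (c σ : ℝ) := rfl

lemma intToReal_add (c c' : SChain ℤ n X) : intToReal (c + c') = intToReal c + intToReal c' := by
  ext σ; simp [intToReal_apply]

lemma intToReal_sbdry (w : SChain ℤ (n + 1) X) :
    intToReal (sbdry ℤ w) = sbdry ℝ (intToReal w) := by
  induction w using Finsupp.induction_linear with
  | zero => ext σ; simp [intToReal]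
  | add a b ha hb => rw [map_add, intToReal_add, intToReal_add, map_add, ha, hb]
  | single σ a =>
    have : intToReal (Finsupp.single σ a) = Finsupp.single σ (a : ℝ) := by
      simp [intToReal]
    rw [this, sbdry_single, sbdry_single]
    ext τ
    classical
    simp only [intToReal_apply, Finsupp.finset_sum_apply, Finsupp.smul_apply, Int.cast_sum,
      Finsupp.single_apply]
    refine Finset.sum_congr rfl fun i _ => ?_
    split_ifs <;> simp

lemma sum_sbdry_le (u : SChain ℝ (n + 1) X) (S : Finset (SingSimplex n X)) :
    ∑ σ ∈ S, |sbdry ℝ u σ| ≤ (n + 2) * ∑ τ ∈ u.support, |u τ| := by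
  classical
  have h1 : ∀ σ, |sbdry ℝ u σ| ≤ ∑ τ ∈ u.support, ∑ i : Fin (n + 2),
      |(Finsupp.single (τ.comp (faceMap i)) (u τ) : SChain ℝ n X) σ| := by
    intro σ
    conv_lhs => rw [← Finsupp.sum_single u, Finsupp.sum, map_sum]
    rw [Finsupp.finset_sum_apply]
    refine (Finset.abs_sum_le_sum_abs _ _).trans (Finset.sum_le_sum fun τ _ => ?_)
    rw [sbdry_single, Finsupp.finset_sum_apply]
    refine (Finset.abs_sum_le_sum_abs _ _).trans (Finset.sum_le_sum fun i _ => ?_)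
    rw [Finsupp.smul_apply]
    rcases neg_one_pow_eq_or ℤ (i : ℕ) with h | h <;> rw [h] <;> simp
  refine (Finset.sum_le_sum fun σ _ => h1 σ).trans ?_
  rw [Finset.sum_comm, Finset.mul_sum]
  refine Finset.sum_le_sum fun τ _ => ?_
  rw [Finset.sum_comm]
  have h2 : ∀ i : Fin (n + 2), ∑ σ ∈ S,
      |(Finsupp.single (τ.comp (faceMap i)) (u τ) : SChain ℝ n X) σ| ≤ |u τ| := by
    intro i
    simp only [Finsupp.single_apply]
    have : ∀ σ ∈ S, |if τ.comp (faceMap i) = σ then u τ else 0|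
      = if τ.comp (faceMap i) = σ then |u τ| else 0 := by
      intro σ _
      split_ifs <;> simp
    rw [Finset.sum_congr rfl this, Finset.sum_ite_eq]
    split_ifs
    · exact le_rfl
    · exact abs_nonneg _
  refine (Finset.sum_le_sum fun i _ => h2 i).trans ?_
  simp

lemma relNorm_eq {R : Type} [NormedCommRing R] (A : Set X) (z : SChain R n X) :
    letI : DecidablePred fun σ : SingSimplex n X => ¬ Set.range ⇑σ ⊆ A :=
      fun _ => Classical.dec _
    relNorm A z = ∑ σ ∈ z.support.filter (fun σ : SingSimplex n X => ¬ Set.range ⇑σ ⊆ A), ‖z σ‖ :=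
  rfl

lemma exists_rounding {B : Set X} {z : SChain ℝ n X} {c : SChain ℤ n X}
    (h : RelHomologous ℝ n B z (intToReal c)) {r : ℝ} (hr : relNorm B z < r) :
    ∃ (k : ℤ) (y : SChain ℤ n X), 0 < k ∧ y - k • c ∈ Bdr ℤ n B ∧ (nrm y : ℝ) ≤ k * r := by
  classical
  obtain ⟨w, hw⟩ := h
  set C : ℝ := (n + 2) * w.support.card with hC
  obtain ⟨k, hk⟩ := exists_nat_gt (C / (r - relNorm B z))
  have hpos : 0 < r - relNorm B z := by linarith
  have hC0 : 0 ≤ C := by positivity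
  have hk0 : (0 : ℝ) < k := lt_of_le_of_lt (by positivity) hk
  have hkC : C ≤ k * (r - relNorm B z) := by
    rw [div_lt_iff₀ hpos] at hk; exact hk.le
  set wk : SChain ℤ (n + 1) X := w.mapRange (fun x => round ((k : ℝ) * x)) (by simp) with hwk
  set v : SChain ℤ n X := (k : ℤ) • c + sbdry ℤ wk with hv
  set y : SChain ℤ n X := v.filter (fun σ : SingSimplex n X => ¬ Set.range σ ⊆ B) with hy
  refine ⟨k, y, by exact_mod_cast hk0, ?_, ?_⟩
  · have h1 : v.filter (fun σ : SingSimplex n X => Set.range σ ⊆ B) ∈ suppOn ℤ n B := by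
      rw [suppOn, Finsupp.mem_supported]
      intro σ hσ
      rw [Finset.mem_coe, Finsupp.support_filter, Finset.mem_filter] at hσ
      exact hσ.2
    have h2 := Finsupp.filter_pos_add_filter_neg v (fun σ : SingSimplex n X => Set.range σ ⊆ B)
    have h3 : y - (k : ℤ) • c = sbdry ℤ wk - v.filter (fun σ : SingSimplex n X => Set.range σ ⊆ B) := by
      have : y = v - v.filter (fun σ : SingSimplex n X => Set.range σ ⊆ B) := by
        rw [eq_sub_iff_add_eq, add_comm]; exact h2
      rw [this, hv]; abel
    rw [h3]
    exact sub_mem (sbdry_mem_Bdr _) (suppOn_le_Bdr h1)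
  · set u : SChain ℝ (n + 1) X := intToReal wk - (k : ℝ) • w with hu
    have hu1 : ∀ τ, |u τ| ≤ 1 := by
      intro τ
      have : u τ = (round ((k : ℝ) * w τ) : ℝ) - k * w τ := by
        simp [hu, intToReal_apply, hwk]
      rw [this, abs_sub_comm]
      exact (abs_sub_round _).trans (by norm_num)
    have hus : u.support ⊆ w.support := by
      intro τ hτ
      rw [Finsupp.mem_support_iff] at hτ ⊢
      intro h0
      apply hτ
      simp [hu, intToReal_apply, hwk, h0]
    have hucard : ∑ τ ∈ u.support, |u τ| ≤ w.support.card := by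
      refine (Finset.sum_le_sum fun τ _ => hu1 τ).trans ?_
      simp only [Finset.sum_const, nsmul_eq_mul, mul_one]
      exact_mod_cast Finset.card_le_card hus
    have hsupp : ∀ σ ∈ y.support, ¬ Set.range σ ⊆ B := by
      intro σ hσ
      rw [hy, Finsupp.support_filter, Finset.mem_filter] at hσ
      exact hσ.2
    have hval : ∀ σ ∈ y.support, |(y σ : ℝ)| ≤ k * ‖z σ‖ + |sbdry ℝ u σ| := by
      intro σ hσ
      have hσB := hsupp σ hσ
      have h1 : y σ = v σ := Finsupp.filter_apply_pos _ _ hσB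
      have h2 : (z - intToReal c - sbdry ℝ w) σ = 0 := by
        by_contra h0
        exact hσB ((Finsupp.mem_supported _ _).1 hw (Finsupp.mem_support_iff.2 h0))
      have h3 : (v σ : ℝ) = k * z σ + sbdry ℝ u σ := by
        have e1 : ((sbdry ℤ wk σ : ℤ) : ℝ) = sbdry ℝ (intToReal wk) σ := by
          rw [← intToReal_sbdry]; rfl
        simp only [Finsupp.sub_apply, intToReal_apply] at h2
        simp only [hv, Finsupp.add_apply, Finsupp.smul_apply, smul_eq_mul, Int.cast_add,
          Int.cast_mul, Int.cast_natCast, e1, hu, map_sub, map_smul, Finsupp.sub_apply]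
        linear_combination (-(k : ℝ)) * h2
      rw [h1, h3]
      refine (abs_add_le _ _).trans ?_
      rw [abs_mul, Nat.abs_cast, Real.norm_eq_abs]
    have hz : ∑ σ ∈ y.support, ‖z σ‖ ≤ relNorm B z := by
      rw [relNorm_eq]
      have : ∑ σ ∈ y.support, ‖z σ‖ = ∑ σ ∈ y.support.filter (fun σ => z σ ≠ 0), ‖z σ‖ := by
        rw [Finset.sum_filter_of_ne]
        intro σ _ h; simpa using h
      rw [this]
      refine Finset.sum_le_sum_of_subset_of_nonneg ?_ (fun _ _ _ => norm_nonneg _)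
      intro σ hσ
      rw [Finset.mem_filter] at hσ
      exact (@Finset.mem_filter _ _ (_) _ _).2 ⟨Finsupp.mem_support_iff.2 hσ.2, hsupp σ hσ.1⟩
    have hn : (nrm y : ℝ) = ∑ σ ∈ y.support, |(y σ : ℝ)| := by
      rw [nrm_eq_sum y _ subset_rfl, Nat.cast_sum]
      refine Finset.sum_congr rfl fun σ _ => ?_
      rw [Nat.cast_natAbs, Int.cast_abs]
    rw [hn]
    calc ∑ σ ∈ y.support, |(y σ : ℝ)| ≤ ∑ σ ∈ y.support, (k * ‖z σ‖ + |sbdry ℝ u σ|) :=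
          Finset.sum_le_sum hval
      _ = k * ∑ σ ∈ y.support, ‖z σ‖ + ∑ σ ∈ y.support, |sbdry ℝ u σ| := by
          rw [Finset.sum_add_distrib, Finset.mul_sum]
      _ ≤ k * relNorm B z + (n + 2) * w.support.card := by
          have h1 := sum_sbdry_le u y.support
          have h2 := mul_le_mul_of_nonneg_left hucard (by positivity : (0 : ℝ) ≤ n + 2)
          have h3 := mul_le_mul_of_nonneg_left hz hk0.le
          linarith
      _ ≤ ((k : ℤ) : ℝ) * r := by
          push_cast
          linarith

lemma simVolOr_spec {B : Set X} (hor : HomOrientable n X B) {ε : ℝ} (hε : 0 < ε) :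
    0 ≤ simVolOr n X B ∧ ∃ (c : SChain ℤ n X) (z : SChain ℝ n X), IsFundCycle n B c ∧
      RelHomologous ℝ n B z (intToReal c) ∧ relNorm B z < simVolOr n X B + ε := by
  constructor
  · refine Real.sInf_nonneg ?_
    rintro _ ⟨z, -, rfl⟩
    exact Finset.sum_nonneg fun _ _ => norm_nonneg _
  · obtain ⟨c, hc, -⟩ := hor
    have hne : {r : ℝ | ∃ z : SChain ℝ n X,
      (∃ c : SChain ℤ n X, IsFundCycle n B c ∧ RelHomologous ℝ n B z (intToReal c)) ∧
      r = relNorm B z}.Nonempty := by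
      refine ⟨_, intToReal c, ⟨c, hc, ?_⟩, rfl⟩
      rw [relHomologous_iff, sub_self]
      exact zero_mem _
    obtain ⟨_, ⟨z, ⟨c', hc', hz⟩, rfl⟩, hlt⟩ :=
      exists_lt_of_csInf_lt hne (lt_add_of_pos_right (simVolOr n X B) hε)
    exact ⟨c', z, hc', hz, hlt⟩

end rounding

section transport
variable {X Y : Type} [TopologicalSpace X] [TopologicalSpace Y] {n : ℕ}

lemma fund_push {A : Set X} {B : Set Y} (f : C(X, Y)) (g : C(Y, X))
    (hfg : f.comp g = ContinuousMap.id Y) (hf : ∀ x ∈ A, f x ∈ B)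
    (hg : ∀ y ∈ B, g y ∈ A) {c : SChain ℤ (n + 1) X} (hc : IsFundCycle (n + 1) A c) :
    IsFundCycle (n + 1) B (push ℤ f (n + 1) c) := by
  constructor
  · change sbdry ℤ _ ∈ suppOn ℤ n B
    rw [sbdry_push]
    exact push_suppOn f hf hc.1
  · intro z hz
    have h1 : IsRelCycle ℤ (n + 1) A (push ℤ g (n + 1) z) := by
      change sbdry ℤ _ ∈ suppOn ℤ n A
      rw [sbdry_push]
      exact push_suppOn g hg hz
    obtain ⟨k, hk⟩ := hc.2 _ h1
    refine ⟨k, ?_⟩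
    rw [relHomologous_iff] at hk ⊢
    have := push_Bdr f hf hk
    rw [map_sub, map_smul, push_push, hfg, push_id] at this
    exact this

lemma hor_push {A : Set X} {B : Set Y} (f : C(X, Y)) (g : C(Y, X))
    (hfg : f.comp g = ContinuousMap.id Y) (hgf : g.comp f = ContinuousMap.id X)
    (hf : ∀ x ∈ A, f x ∈ B)
    (hg : ∀ y ∈ B, g y ∈ A) (h : HomOrientable (n + 1) X A) : HomOrientable (n + 1) Y B := by
  obtain ⟨c, hc, hn⟩ := h
  refine ⟨_, fund_push f g hfg hf hg hc, fun h0 => hn ?_⟩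
  rw [relHomologous_iff, sub_zero] at h0 ⊢
  have := push_Bdr g hg h0
  rwa [push_push, hgf, push_id] at this

lemma exists_eff {m : ℕ} {M : Type} [TopologicalSpace M] [ConnectedSpace M] {A : Set M}
    (hor : HomOrientable (m + 2) M A) {ε : ℝ} (hε : 0 < ε) :
    0 < SimVol (m + 2) M A + ε ∧ ∃ c : SChain ℤ (m + 2) M, IsFundCycle (m + 2) A c ∧
      ∃ z, Eff A c (SimVol (m + 2) M A + ε) z := by
  classical
  let x0 : M := Classical.arbitrary M
  let c0 : ConnectedComponents M := ConnectedComponents.mk x0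
  have hx : ∀ x : M, ConnectedComponents.mk x = c0 := fun x => by
    rw [ConnectedComponents.coe_eq_coe']
    simp
  have hsub : ∀ c : ConnectedComponents M, c = c0 := by
    intro c
    obtain ⟨x, rfl⟩ := ConnectedComponents.surjective_coe c
    exact hx x
  have hV : SimVol (m + 2) M A = simVolConn (m + 2) {x : M // ConnectedComponents.mk x = c0}
      {x | ↑x ∈ A} := by
    unfold SimVol
    exact finsum_eq_single _ c0 fun c hc => absurd (hsub c) hc
  let g : C({x : M // ConnectedComponents.mk x = c0}, M) := ⟨Subtype.val, continuous_subtype_val⟩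
  let f : C(M, {x : M // ConnectedComponents.mk x = c0}) :=
    ⟨fun x => ⟨x, hx x⟩, continuous_id.subtype_mk _⟩
  have hgf : g.comp f = ContinuousMap.id M := rfl
  have hfg : f.comp g = ContinuousMap.id _ := rfl
  have hf : ∀ x ∈ A, f x ∈ {x : {x : M // ConnectedComponents.mk x = c0} | ↑x ∈ A} :=
    fun x hx => hx
  have hg : ∀ x ∈ {x : {x : M // ConnectedComponents.mk x = c0} | ↑x ∈ A}, g x ∈ A :=
    fun x hx => hx
  have horY : HomOrientable (m + 2) {x : M // ConnectedComponents.mk x = c0} {x | ↑x ∈ A} :=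
    hor_push f g hfg hgf hf hg hor
  have hV2 : SimVol (m + 2) M A = simVolOr (m + 2) {x : M // ConnectedComponents.mk x = c0}
      {x | ↑x ∈ A} := by
    rw [hV]; unfold simVolConn
    exact if_pos horY
  obtain ⟨h0, c, z, hc, hz, hlt⟩ := simVolOr_spec horY hε
  rw [← hV2] at h0 hlt
  have hr : 0 < SimVol (m + 2) M A + ε := by linarith
  obtain ⟨k, y, hk, hy, hny⟩ := exists_rounding hz hlt
  have hcM := fund_push g f hgf hg hf hc
  refine ⟨hr, _, hcM, ?_⟩
  obtain ⟨cc, hcc, hcn⟩ := hor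
  have hnot : push ℤ g (m + 2) c ∉ Bdr ℤ (m + 2) A := by
    intro hb
    apply hcn
    obtain ⟨l, hl⟩ := hcM.2 cc hcc.1
    rw [relHomologous_iff] at hl ⊢
    rw [sub_zero]
    exact mem_of_sub_mem hl (Submodule.smul_mem _ _ hb)
  rcases torsion_or A (push ℤ g (m + 2) c) with ⟨k0, hk0, ht⟩ | hnt
  · exact ⟨push ℤ g (m + 2) c, Eff.of_torsion hr
      (fun z hz => by
        obtain ⟨l, hl⟩ := hcM.2 z hz
        exact ⟨l, relHomologous_iff.1 hl⟩) hk0 ht hcM.1 hnot⟩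
  · have hy' := push_Bdr g hg hy
    rw [map_sub, map_smul] at hy'
    refine ⟨push ℤ g (m + 2) y, fun hb => ?_, k, hk, hy', ?_⟩
    · have := sub_mem hb hy'
      rw [sub_sub_cancel] at this
      have := hnt _ this
      omega
    · refine le_trans ?_ hny
      exact_mod_cast nrm_mapDomain_le _ y

end transport

/-! ## Pairings -/

lemma exists_pairing {α : Type} [Finite α] (R : α → α → Prop) (hs : ∀ a b, R a b → R b a)
    (hi : ∀ a b, R a b → a ≠ b) :
    ∃ p : α → Option α, (∀ a b, p a = some b → p b = some a) ∧ (∀ a b, p a = some b → R a b) ∧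
      ∀ a b, p a = none → p b = none → ¬ R a b := by
  classical
  have := Fintype.ofFinite α
  let T := {p : α → Option α // (∀ a b, p a = some b → p b = some a) ∧ ∀ a b, p a = some b → R a b}
  have hT : Nonempty T := ⟨⟨fun _ => none, by simp, by simp⟩⟩
  obtain ⟨⟨p, hp1, hp2⟩, hmax⟩ :=
    Finite.exists_max (fun p : T => (Finset.univ.filter fun a => p.1 a ≠ none).card)
  refine ⟨p, hp1, hp2, fun a b ha hb hab => ?_⟩
  have hne := hi a b hab
  let q : α → Option α := fun x => if x = a then some b else if x = b then some a else p x
  have hq1 : ∀ x y, q x = some y → q y = some x := by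
    intro x y hxy
    by_cases hxa : x = a
    · subst hxa
      have : b = y := by simpa [q] using hxy
      subst this
      simp [q, hne.symm]
    · by_cases hxb : x = b
      · subst hxb
        have : a = y := by simpa [q, hne.symm] using hxy
        subst this
        simp [q]
      · have h1 : p x = some y := by simpa [q, hxa, hxb] using hxy
        have h2 := hp1 _ _ h1
        have hya : y ≠ a := by rintro rfl; rw [ha] at h2; simp at h2
        have hyb : y ≠ b := by rintro rfl; rw [hb] at h2; simp at h2
        simpa [q, hya, hyb] using h2
  have hq2 : ∀ x y, q x = some y → R x y := by
    intro x y hxy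
    by_cases hxa : x = a
    · subst hxa
      have : b = y := by simpa [q] using hxy
      subst this
      exact hab
    · by_cases hxb : x = b
      · subst hxb
        have : a = y := by simpa [q, hne.symm] using hxy
        subst this
        exact hs _ _ hab
      · exact hp2 _ _ (by simpa [q, hxa, hxb] using hxy)
  have h := hmax ⟨q, hq1, hq2⟩
  refine absurd h (not_le.2 (Finset.card_lt_card ?_))
  rw [Finset.ssubset_iff]
  refine ⟨a, by simp [ha], ?_⟩
  intro x hx
  rw [Finset.mem_insert] at hx
  rw [Finset.mem_filter]
  refine ⟨Finset.mem_univ _, ?_⟩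
  rcases hx with rfl | hx
  · simp [q]
  · have hx' : p x ≠ none := (Finset.mem_filter.1 hx).2
    have hxa : x ≠ a := by rintro rfl; exact hx' ha
    have hxb : x ≠ b := by rintro rfl; exact hx' hb
    simpa [q, hxa, hxb] using hx'

lemma sum_paired {α V : Type} [AddCommGroup V] (p : α → Option α)
    (hp : ∀ a b, p a = some b → p b = some a) (hne : ∀ a b, p a = some b → a ≠ b)
    (f : α → V) (hf : ∀ a b, p a = some b → f a + f b = 0) (T : Finset α)
    (hT : ∀ a ∈ T, ∃ b ∈ T, p a = some b) : ∑ a ∈ T, f a = 0 := by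
  classical
  choose! g hg1 hg2 using hT
  refine Finset.sum_involution (fun a _ => g a) ?_ ?_ ?_ ?_
  · intro a ha; exact hf _ _ (hg2 a ha)
  · intro a ha _ h; exact hne _ _ (hg2 a ha) h.symm
  · intro a ha; exact hg1 a ha
  · intro a ha
    have h1 := hp _ _ (hg2 a ha)
    have h2 := hg2 _ (hg1 a ha)
    rw [h1] at h2
    exact (Option.some.inj h2).symm

section fam
variable {M : Type} [TopologicalSpace M] {m : ℕ} {A : Set M} {N : ℕ}
  (eps : Fin N → ℤ) (σ : Fin N → SingSimplex (m + 2) M)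

/-- part of the chain of a family -/
def part (S : Finset (Fin N)) : SChain ℤ (m + 2) M := ∑ i ∈ S, eps i • Finsupp.single (σ i) (1 : ℤ)

/-- the contribution of a flag to the boundary -/
def flg (a : Fin N × Fin (m + 3)) : SChain ℤ (m + 1) M :=
  Finsupp.single ((σ a.1).comp (faceMap a.2)) ((-1) ^ (a.2 : ℕ) * eps a.1)

lemma sbdry_part (S : Finset (Fin N)) :
    sbdry ℤ (part eps σ S) = ∑ a ∈ S ×ˢ (Finset.univ : Finset (Fin (m + 3))), flg eps σ a := by
  unfold part
  rw [map_sum, Finset.sum_product]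
  refine Finset.sum_congr rfl fun i _ => ?_
  rw [map_smul, sbdry_single, Finset.smul_sum]
  refine Finset.sum_congr rfl fun j _ => ?_
  unfold flg
  rw [smul_smul, mul_comm]
  simp

lemma sbdry_part_closed (P : AssocPseudomanifold (m + 2) eps σ) (S : Finset (Fin N))
    (hS : ∀ a b, P.pair a = some b → a.1 ∈ S → b.1 ∈ S) :
    sbdry ℤ (part eps σ S) = ∑ a ∈ (S ×ˢ (Finset.univ : Finset (Fin (m + 3)))).filter
      (fun a => P.pair a = none), flg eps σ a := by
  rw [sbdry_part, ← Finset.sum_filter_add_sum_filter_not _ (fun a => P.pair a = none)]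
  rw [add_eq_left]
  refine sum_paired P.pair P.symm (fun a b h => (P.cancel a b h).1) _ ?_ _ ?_
  · intro a b h
    obtain ⟨-, h1, h2⟩ := P.cancel a b h
    change (σ a.1).comp (faceMap a.2) = (σ b.1).comp (faceMap b.2) at h1
    unfold flg
    rw [h1, ← Finsupp.single_add, h2, Finsupp.single_zero]
  · intro a ha
    rw [Finset.mem_filter, Finset.mem_product] at ha
    obtain ⟨b, hb⟩ := Option.ne_none_iff_exists'.1 ha.2
    refine ⟨b, ?_, hb⟩
    rw [Finset.mem_filter, Finset.mem_product]
    refine ⟨⟨hS a b hb ha.1.1, Finset.mem_univ _⟩, ?_⟩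
    rw [P.symm a b hb]; simp

lemma sg_eq (heps : ∀ i, eps i = 1 ∨ eps i = -1) (a : Fin N × Fin (m + 3)) :
    (-1 : ℤ) ^ (a.2 : ℕ) * eps a.1 = 1 ∨ (-1 : ℤ) ^ (a.2 : ℕ) * eps a.1 = -1 := by
  rcases neg_one_pow_eq_or ℤ (a.2 : ℕ) with h | h <;> rcases heps a.1 with h' | h' <;>
    rw [h, h'] <;> simp

lemma unpaired_sub (heps : ∀ i, eps i = 1 ∨ eps i = -1) (P : AssocPseudomanifold (m + 2) eps σ)
    (hz : RC A (part eps σ Finset.univ)) (a : Fin N × Fin (m + 3)) (ha : P.pair a = none) :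
    Set.range ((σ a.1).comp (faceMap a.2)) ⊆ A := by
  classical
  by_contra hA
  set τ := (σ a.1).comp (faceMap a.2) with hτ
  have h0 : sbdry ℤ (part eps σ Finset.univ) τ = 0 := by
    by_contra h
    exact hA ((Finsupp.mem_supported _ _).1 hz (Finsupp.mem_support_iff.2 h))
  rw [sbdry_part_closed eps σ P _ (fun _ _ _ _ => Finset.mem_univ _),
    Finsupp.finset_sum_apply] at h0
  set u : ℤ := (-1 : ℤ) ^ (a.2 : ℕ) * eps a.1 with hu
  have h1 : 0 < u * ∑ x ∈ ((Finset.univ : Finset (Fin N)) ×ˢ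
      (Finset.univ : Finset (Fin (m + 3)))).filter
      (fun a => P.pair a = none), flg eps σ x τ := by
    rw [Finset.mul_sum]
    refine Finset.sum_pos' (fun b hb => ?_) ⟨a, by simp [ha], ?_⟩
    · unfold flg
      rw [Finsupp.single_apply]
      split_ifs with hbt
      · by_cases hab : a = b
        · subst hab; exact mul_self_nonneg _
        · have h2 := P.maximal a b ha (Finset.mem_filter.1 hb).2
          have h3 : (-1 : ℤ) ^ (a.2 : ℕ) * eps a.1 + (-1 : ℤ) ^ (b.2 : ℕ) * eps b.1 ≠ 0 :=
            fun h4 => h2 ⟨hab, hbt.symm, h4⟩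
          rw [← hu] at h3
          rcases sg_eq eps heps a with h5 | h5 <;> rcases sg_eq eps heps b with h6 | h6 <;>
            rw [← hu] at h5 <;> rw [h5, h6] at h3 ⊢ <;> simp at h3 ⊢
      · simp
    · unfold flg
      rw [← hτ, Finsupp.single_eq_same]
      rcases sg_eq eps heps a with h5 | h5 <;> rw [← hu] at h5 ⊢ <;> rw [h5] <;> simp
  rw [h0] at h1
  simp at h1

lemma part_RC (heps : ∀ i, eps i = 1 ∨ eps i = -1) (P : AssocPseudomanifold (m + 2) eps σ)
    (hz : RC A (part eps σ Finset.univ)) (S : Finset (Fin N))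
    (hS : ∀ a b, P.pair a = some b → a.1 ∈ S → b.1 ∈ S) : RC A (part eps σ S) := by
  unfold RC
  rw [sbdry_part_closed eps σ P S hS]
  refine sum_mem fun a ha => ?_
  exact single_mem_suppOn (unpaired_sub eps σ heps P hz a (Finset.mem_filter.1 ha).2) _

lemma nrm_part_le (heps : ∀ i, eps i = 1 ∨ eps i = -1) (S : Finset (Fin N)) :
    nrm (part eps σ S) ≤ S.card := by
  unfold part
  refine (nrm_sum_le _ _).trans ?_
  rw [Finset.card_eq_sum_ones]
  refine Finset.sum_le_sum fun i _ => ?_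
  rw [nrm_smul, nrm_single]
  rcases heps i with h | h <;> rw [h] <;> simp

lemma part_support (S : Finset (Fin N)) (ρ : SingSimplex (m + 2) M)
    (h : ρ ∈ (part eps σ S).support) : ∃ i, ρ = σ i := by
  classical
  unfold part at h
  have h1 := Finsupp.support_finsetSum h
  rw [Finset.mem_biUnion] at h1
  obtain ⟨l, -, hl⟩ := h1
  have h2 := Finsupp.support_single_subset (Finsupp.support_smul hl)
  rw [Finset.mem_singleton] at h2
  exact ⟨l, h2⟩

lemma nrm_real {ι : Type} (z : ι →₀ ℤ) : (nrm z : ℝ) = ∑ σ ∈ z.support, ‖z σ‖ := by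
  rw [nrm_eq_sum z _ subset_rfl, Nat.cast_sum]
  refine Finset.sum_congr rfl fun σ _ => ?_
  rw [Nat.cast_natAbs, Int.cast_abs, Int.norm_eq_abs]

lemma relNorm_le {k : ℕ} (B : Set M) (z : SChain ℤ k M) : relNorm B z ≤ nrm z := by
  rw [nrm_real, relNorm_eq]
  exact Finset.sum_le_sum_of_subset_of_nonneg (@Finset.filter_subset _ _ (_) _)
    (fun _ _ _ => norm_nonneg _)

lemma relNorm_eq_nrm {k : ℕ} (B : Set M) (z : SChain ℤ k M)
    (h : ∀ σ ∈ z.support, ¬ Set.range σ ⊆ B) : relNorm B z = nrm z := by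
  rw [nrm_real, relNorm_eq]
  rw [@Finset.filter_true_of_mem _ _ (_) _ h]

end fam

theorem final_aux {m : ℕ} {M : Type} [TopologicalSpace M] [ConnectedSpace M] (A : Set M)
    (hor : HomOrientable (m + 2) M A) (ε : ℝ) (hε : 0 < ε) :
    ∃ (N : ℕ) (eps : Fin N → ℤ) (σ : Fin N → SingSimplex (m + 2) M)
      (P : AssocPseudomanifold (m + 2) eps σ) (z : SChain ℤ (m + 2) M),
      z = ∑ i, eps i • Finsupp.single (σ i) (1 : ℤ) ∧
      (∀ i, eps i = 1 ∨ eps i = -1) ∧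
      RC A z ∧
      (∃ (c : SChain ℤ (m + 2) M) (d : ℤ), IsFundCycle (m + 2) A c ∧ 0 < d ∧
        RelHomologous ℤ (m + 2) A z (d • c) ∧
        relNorm A z / (d : ℝ) ≤ SimVol (m + 2) M A + ε) ∧
      (dualGraph P).Connected ∧
      (∀ i : Fin N,
        (Finset.univ.filter fun j : Fin (m + 3) => P.pair (i, j) = none).card ≤ m + 1) ∧
      relNorm (∅ : Set M) (sbdry ℤ z) ≤ (m + 1 : ℝ) * relNorm A z := by
  classical
  obtain ⟨hr, c, hc, z0, hz0⟩ := exists_eff hor hε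
  set r := SimVol (m + 2) M A + ε with hrdef
  have hgen : ∀ z : SChain ℤ (m + 2) M, RC A z → ∃ k : ℤ, z - k • c ∈ Bdr ℤ (m + 2) A := by
    intro z hz
    obtain ⟨l, hl⟩ := hc.2 z hz
    exact ⟨l, relHomologous_iff.1 hl⟩
  have hcr : RC A c := hc.1
  have hex : ∃ N, ∃ z : SChain ℤ (m + 2) M, nrm z = N ∧ Eff A c r z ∧ TwoFree A z := by
    obtain ⟨w, hw1, hw2⟩ := exists_eff_twoFree hr hcr hgen _ z0 rfl hz0
    exact ⟨_, w, rfl, hw1, hw2⟩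
  set N := Nat.find hex with hN
  obtain ⟨z, hzN, hzE, hzT⟩ := Nat.find_spec hex
  have hmin : ∀ y : SChain ℤ (m + 2) M, Eff A c r y → TwoFree A y → N ≤ nrm y := fun y h1 h2 =>
    Nat.find_min' hex ⟨y, rfl, h1, h2⟩
  rw [← hN] at hzN
  obtain ⟨eps, σ, hzsum, heps, hσ⟩ := exists_family N z hzN
  have hzpart : z = part eps σ Finset.univ := hzsum
  obtain ⟨p, hp1, hp2, hp3⟩ := exists_pairing (Cancelling (m + 2) σ eps)
    (fun a b h => ⟨h.1.symm, h.2.1.symm, by rw [add_comm]; exact h.2.2⟩) (fun a b h => h.1)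
  let P : AssocPseudomanifold (m + 2) eps σ := ⟨p, hp1, hp2, hp3⟩
  have hzR : RC A z := hzE.rc hcr
  have hzR' : RC A (part eps σ Finset.univ) := hzpart ▸ hzR
  have hcard : ∀ i : Fin N,
      (Finset.univ.filter fun j : Fin (m + 3) => P.pair (i, j) = none).card ≤ m + 1 := by
    intro i
    obtain ⟨j, j', hjj, h1, h2⟩ := hzT (σ i) (hσ i)
    have hsub : (Finset.univ.filter fun j : Fin (m + 3) => P.pair (i, j) = none)
        ⊆ (Finset.univ.erase j).erase j' := by
      intro l hl
      have hl' := unpaired_sub eps σ heps P hzR' (i, l) (Finset.mem_filter.1 hl).2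
      rw [Finset.mem_erase, Finset.mem_erase]
      refine ⟨?_, ?_, Finset.mem_univ _⟩
      · rintro rfl; exact h2 hl'
      · rintro rfl; exact h1 hl'
    refine (Finset.card_le_card hsub).trans ?_
    rw [Finset.card_erase_of_mem (by simp [hjj.symm]), Finset.card_erase_of_mem (by simp)]
    simp
  have hzA : ∀ ρ ∈ z.support, ¬ Set.range ρ ⊆ A := by
    intro ρ hρ hsub
    obtain ⟨j, j', -, h1, -⟩ := hzT ρ hρ
    exact h1 (range_comp_sub hsub _)
  refine ⟨N, eps, σ, P, z, hzsum, heps, hzR, ?_, ?_, hcard, ?_⟩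
  · obtain ⟨-, d, hd, h1, h2⟩ := hzE
    refine ⟨c, d, hc, hd, relHomologous_iff.2 h1, ?_⟩
    have hd' : (0 : ℝ) < d := by exact_mod_cast hd
    rw [div_le_iff₀ hd', mul_comm]
    exact (relNorm_le A z).trans h2
  · have hN0 : 0 < N := by
      rcases Nat.eq_zero_or_pos N with h | h
      · rw [h] at hzN
        exact absurd (by rw [nrm_eq_zero hzN]; exact zero_mem _) hzE.1
      · exact h
    let i0 : Fin N := ⟨0, hN0⟩
    rw [SimpleGraph.connected_iff_exists_forall_reachable]
    refine ⟨i0, ?_⟩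
    by_contra! hcon
    obtain ⟨i1, hi1⟩ := hcon
    let S : Finset (Fin N) := Finset.univ.filter fun i => (dualGraph P).Reachable i0 i
    have hS : ∀ a b, P.pair a = some b → a.1 ∈ S → b.1 ∈ S := by
      intro a b hab ha
      have ha' : (dualGraph P).Reachable i0 a.1 := (Finset.mem_filter.1 ha).2
      refine Finset.mem_filter.2 ⟨Finset.mem_univ _, ?_⟩
      by_cases hne : a.1 = b.1
      · rw [← hne]; exact ha'
      · refine ha'.trans (SimpleGraph.Adj.reachable ?_)
        unfold dualGraph
        rw [SimpleGraph.fromRel_adj]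
        exact ⟨hne, Or.inl ⟨a.2, b.2, hab⟩⟩
    have hSc : ∀ a b, P.pair a = some b → a.1 ∈ Sᶜ → b.1 ∈ Sᶜ := by
      intro a b hab ha
      rw [Finset.mem_compl] at ha ⊢
      exact fun hb => ha (hS b a (P.symm a b hab) hb)
    have hsum : part eps σ S + part eps σ Sᶜ = z := by
      rw [hzsum]; exact Finset.sum_add_sum_compl S _
    have n1 := nrm_part_le eps σ heps S
    have n2 := nrm_part_le eps σ heps Sᶜ
    have n3 := Finset.card_add_card_compl S
    rw [Fintype.card_fin] at n3
    have n4 : 0 < S.card := Finset.card_pos.2 ⟨i0, Finset.mem_filter.2 ⟨Finset.mem_univ _,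
      SimpleGraph.Reachable.refl _⟩⟩
    have n5 : 0 < Sᶜ.card := Finset.card_pos.2 ⟨i1, by
      rw [Finset.mem_compl]
      exact fun h => hi1 (Finset.mem_filter.1 h).2⟩
    have tf : ∀ S', TwoFree A (part eps σ S') := by
      intro S' ρ hρ
      obtain ⟨i, rfl⟩ := part_support eps σ S' ρ hρ
      exact hzT _ (hσ i)
    rcases eff_split hr hgen (z1 := part eps σ S) (z2 := part eps σ Sᶜ) (by rw [hsum]; exact hzE)
      (part_RC eps σ heps P hzR' S hS) (part_RC eps σ heps P hzR' Sᶜ hSc)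
      (by rw [hsum, hzN]; omega) with h | h
    · have := hmin _ h (tf _); omega
    · have := hmin _ h (tf _); omega
  · rw [relNorm_eq_nrm A z hzA]
    refine (relNorm_le _ _).trans ?_
    have h1 : nrm (sbdry ℤ z) ≤ (m + 1) * nrm z := by
      rw [hzN, hzpart, sbdry_part_closed eps σ P _ (fun _ _ _ _ => Finset.mem_univ _)]
      refine (nrm_sum_le _ _).trans ?_
      rw [Finset.sum_filter, Finset.sum_product]
      have h2 : ∀ i ∈ (Finset.univ : Finset (Fin N)), (∑ j : Fin (m + 3),
          if P.pair (i, j) = none then nrm (flg eps σ (i, j)) else 0) ≤ m + 1 := by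
        intro i _
        refine le_trans ?_ (hcard i)
        rw [← Finset.sum_filter, Finset.card_eq_sum_ones]
        refine Finset.sum_le_sum fun j _ => ?_
        unfold flg
        rw [nrm_single]
        rcases sg_eq eps heps (i, j) with h | h <;> rw [h] <;> simp
      refine (Finset.sum_le_sum h2).trans ?_
      simp [mul_comm]
    exact_mod_cast h1

/-- **Statement 12.**  Every compact connected oriented `n`-manifold, `n ≥ 2`, admits, for
every `ε > 0`, an integral relative cycle `z` with associated pseudomanifold `P` such that:
(1) `[z] = d·[M,∂M]` for some `d > 0` and `‖z‖_ℤ/d ≤ ‖M,∂M‖ + ε`; (2) `P` is connected;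
(3) every `n`-simplex of `P` has at most `n-1` boundary faces, and in particular
`‖∂z‖_ℤ ≤ (n-1)·‖z‖_ℤ`. -/
theorem exists_good_integral_cycle (n : ℕ) (hn : 2 ≤ n) (M : Type) [TopologicalSpace M]
    [CompactSpace M] (hM : IsManifoldWithBoundary n M) (hc : ConnectedSpace M)
    (hor : HomOrientable n M (intBoundary n M)) (ε : ℝ) (hε : 0 < ε) :
    ∃ (N : ℕ) (eps : Fin N → ℤ) (σ : Fin N → SingSimplex n M)
      (P : AssocPseudomanifold n eps σ) (z : SChain ℤ n M),
      z = ∑ i, eps i • Finsupp.single (σ i) (1 : ℤ) ∧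
      (∀ i, eps i = 1 ∨ eps i = -1) ∧
      IsRelCycle ℤ n (intBoundary n M) z ∧
      (∃ (c : SChain ℤ n M) (d : ℤ), IsFundCycle n (intBoundary n M) c ∧ 0 < d ∧
        RelHomologous ℤ n (intBoundary n M) z (d • c) ∧
        relNorm (intBoundary n M) z / (d : ℝ) ≤ SimVol n M (intBoundary n M) + ε) ∧
      (dualGraph P).Connected ∧
      (∀ i : Fin N,
        (Finset.univ.filter fun j : Fin (n + 1) => P.pair (i, j) = none).card ≤ n - 1) ∧
      relNorm (∅ : Set M) (sbdryN ℤ n z) ≤ ((n : ℝ) - 1) * relNorm (intBoundary n M) z := by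
  obtain ⟨m, rfl⟩ : ∃ m, n = m + 2 := ⟨n - 2, by omega⟩
  obtain ⟨N, eps, σ, P, z, h1, h2, h3, h4, h5, h6, h7⟩ :=
    final_aux (intBoundary (m + 2) M) hor ε hε
  refine ⟨N, eps, σ, P, z, h1, h2, h3, h4, h5, h6, ?_⟩
  have e : ((m + 2 : ℕ) : ℝ) - 1 = m + 1 := by push_cast; ring
  rw [e]
  exact h7

end
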